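/- arXiv:1902.09410 — 4 statements merged into one kernel-verified Lean document; each statement's English description precedes it below -/
import Mathlib

section
/- Let π: Γ̃ → Γ be an unramified double cover of tropical curves. Then the dilation cycle of π is a union of cycles and isolated points: for every point p of the dilation cycle, the number of edges emanating from p that lie in the dilation cycle is even, so either p is an isolated point of the dilation cycle, or p lies on a cycle (a subset homeomorphic to a circle) contained entirely in the dilation cycle. -/
/-!
Metric graphs (models with a fixed orientation and positive edge lengths) and
finite harmonic morphisms that are linear on every edge.
-/

/-- A model of a compact metric graph: a finite (multi)graph with a chosen
orientation of each edge and positive edge lengths. -/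
structure MGraph where
  V : Type
  E : Type
  [fV : Fintype V]
  [fE : Fintype E]
  [dV : DecidableEq V]
  [dE : DecidableEq E]
  src : E → V
  tgt : E → V
  len : E → ℝ
  len_pos : ∀ e, 0 < len e

attribute [instance] MGraph.fV MGraph.fE MGraph.dV MGraph.dE

namespace MGraph

/-- The darts (tangent directions) based at a vertex `v`: an edge together with
the information of whether it emanates from `v` at its source or target end.
A loop edge at `v` contributes two darts. -/
def dartsAt (G : MGraph) (v : G.V) : Finset (G.E × Bool) :=
  Finset.univ.filter fun d => (d.2 = true ∧ G.src d.1 = v) ∨ (d.2 = false ∧ G.tgt d.1 = v)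

/-- The base vertex of a dart. -/
def dartBase (G : MGraph) (d : G.E × Bool) : G.V :=
  if d.2 then G.src d.1 else G.tgt d.1

/-- The head vertex of a dart. -/
def dartHead (G : MGraph) (d : G.E × Bool) : G.V :=
  if d.2 then G.tgt d.1 else G.src d.1

/-- The slope along an (oriented) edge of a function on the vertices, regarded
as the piecewise linear interpolation that is linear on each edge. -/
noncomputable def slope (G : MGraph) (f : G.V → ℝ) (e : G.E) : ℝ :=
  (f (G.tgt e) - f (G.src e)) / G.len e

/-- Connectivity of the metric graph. -/
def Preconnected (G : MGraph) : Prop :=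
  ∀ v w : G.V, Relation.ReflTransGen
    (fun a b => ∃ e : G.E, (G.src e = a ∧ G.tgt e = b) ∨ (G.src e = b ∧ G.tgt e = a)) v w

end MGraph

/-- A finite harmonic morphism of metric graphs (with models chosen so that the
morphism is linear on every edge, mapping vertices to vertices and edges to
edges, preserving the chosen orientations, and dilating the edge `e` by the
positive integer factor `d e`, so that `d e · len e = len (mapE e)`).
Harmonicity says that the local degree `locdeg ṽ`, computed as the sum of the
dilation factors over all darts at `ṽ` above a fixed dart at the image vertex,
is independent of the chosen dart; `deg` is the (global) degree. -/
structure HarmonicMorphism (Gt G : MGraph) where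
  mapV : Gt.V → G.V
  mapE : Gt.E → G.E
  d : Gt.E → ℕ
  d_pos : ∀ e, 0 < d e
  map_src : ∀ e, G.src (mapE e) = mapV (Gt.src e)
  map_tgt : ∀ e, G.tgt (mapE e) = mapV (Gt.tgt e)
  map_len : ∀ e, (d e : ℝ) * Gt.len e = G.len (mapE e)
  surjV : Function.Surjective mapV
  surjE : Function.Surjective mapE
  locdeg : Gt.V → ℕ
  harmonic : ∀ (vt : Gt.V) (dl : G.E × Bool), dl ∈ G.dartsAt (mapV vt) →
    locdeg vt = ∑ dt ∈ (Gt.dartsAt vt).filter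
      (fun dt => mapE dt.1 = dl.1 ∧ dt.2 = dl.2), d dt.1
  deg : ℕ
  deg_eq : ∀ v : G.V, deg = ∑ vt ∈ Finset.univ.filter (fun vt => mapV vt = v), locdeg vt

/-! ### Unramified double covers of tropical curves -/

/-- An unramified double cover of tropical curves: a surjective finite harmonic
morphism of degree `2` between metric graphs equipped with genus (vertex weight)
functions, whose ramification divisor vanishes. -/
structure UnramDoubleCover (Gt G : MGraph) extends HarmonicMorphism Gt G where
  gwt : Gt.V → ℕ
  gw : G.V → ℕ
  deg_two : deg = 2
  unramified : ∀ vt : Gt.V,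
    (locdeg vt : ℤ) * (2 - 2 * (gw (mapV vt) : ℤ)) - (2 - 2 * (gwt vt : ℤ))
      - ∑ dt ∈ Gt.dartsAt vt, ((d dt.1 : ℤ) - 1) = 0

namespace UnramDoubleCover

variable {Gt G : MGraph}

/-- A vertex of the base lies in the dilation cycle: its preimage consists of a
single point, of local degree `2`. -/
def IsDilatedV (pi : UnramDoubleCover Gt G) (v : G.V) : Prop :=
  ∃ vt, pi.mapV vt = v ∧ pi.locdeg vt = 2 ∧ ∀ vt', pi.mapV vt' = v → vt' = vt

/-- An edge of the base lies in the dilation cycle: its preimage consists of a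
single edge, with dilation factor `2`. -/
def IsDilatedE (pi : UnramDoubleCover Gt G) (e : G.E) : Prop :=
  ∃ et, pi.mapE et = e ∧ pi.d et = 2 ∧ ∀ et', pi.mapE et' = e → et' = et

/-- The dilation cycle is empty (equivalently, `π` is a topological cover). -/
def DilationEmpty (pi : UnramDoubleCover Gt G) : Prop :=
  (∀ v, ¬ pi.IsDilatedV v) ∧ (∀ e, ¬ pi.IsDilatedE e)

end UnramDoubleCover

open scoped Classical

/-- A simple cycle (a subset homeomorphic to a circle) through the vertex `v`,
all of whose edges satisfy `P`: a cyclic sequence of darts, consecutively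
incident, with pairwise distinct base vertices and pairwise distinct edges. -/
def SimpleCycleThroughV (G : MGraph) (P : G.E → Prop) (v : G.V) : Prop :=
  ∃ n : ℕ, 0 < n ∧ ∃ f : ZMod n → G.E × Bool,
    (∀ i, P (f i).1) ∧
    (∀ i, G.dartHead (f i) = G.dartBase (f (i + 1))) ∧
    Function.Injective (fun i => G.dartBase (f i)) ∧
    Function.Injective (fun i => (f i).1) ∧
    ∃ i, G.dartBase (f i) = v

/-- A simple cycle containing the edge `e`, all of whose edges satisfy `P`. -/
def SimpleCycleThroughE (G : MGraph) (P : G.E → Prop) (e : G.E) : Prop :=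
  ∃ n : ℕ, 0 < n ∧ ∃ f : ZMod n → G.E × Bool,
    (∀ i, P (f i).1) ∧
    (∀ i, G.dartHead (f i) = G.dartBase (f (i + 1))) ∧
    Function.Injective (fun i => G.dartBase (f i)) ∧
    Function.Injective (fun i => (f i).1) ∧
    ∃ i, (f i).1 = e

theorem MGraph.mem_dartsAt (G : MGraph) (v : G.V) (d : G.E × Bool) :
    d ∈ G.dartsAt v ↔ G.dartBase d = v := by
  rcases d with ⟨e, b⟩
  cases b <;> simp [MGraph.dartsAt, MGraph.dartBase]

def MGraph.dartFlip (G : MGraph) (d : G.E × Bool) : G.E × Bool := (d.1, !d.2)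

theorem MGraph.base_flip (G : MGraph) (d : G.E × Bool) :
    G.dartBase (G.dartFlip d) = G.dartHead d := by
  rcases d with ⟨e, b⟩
  cases b <;> simp [MGraph.dartFlip, MGraph.dartBase, MGraph.dartHead]

theorem MGraph.head_flip (G : MGraph) (d : G.E × Bool) :
    G.dartHead (G.dartFlip d) = G.dartBase d := by
  rcases d with ⟨e, b⟩
  cases b <;> simp [MGraph.dartFlip, MGraph.dartBase, MGraph.dartHead]

theorem MGraph.eq_or_flip (G : MGraph) (d d' : G.E × Bool) (h : d.1 = d'.1) :
    d = d' ∨ d = G.dartFlip d' := by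
  rcases d with ⟨e, b⟩
  rcases d' with ⟨e', b'⟩
  cases b <;> cases b' <;> simp_all [MGraph.dartFlip]

theorem MGraph.even_card_of_flip (G : MGraph) (S : Finset (G.E × Bool))
    (h : ∀ d ∈ S, G.dartFlip d ∈ S) : Even S.card := by
  rw [← ZMod.natCast_eq_zero_iff_even, Finset.card_eq_sum_ones, Nat.cast_sum]
  refine Finset.sum_involution (fun d _ => G.dartFlip d) ?_ ?_ h ?_
  · intro d _; decide
  · rintro ⟨e, b⟩ _ _
    simp [MGraph.dartFlip]
  · rintro ⟨e, b⟩ _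
    simp [MGraph.dartFlip]

/-- The simple graph of edges satisfying `P` and different from `e`. -/
def MGraph.avoid (G : MGraph) (P : G.E → Prop) (e : G.E) : SimpleGraph G.V where
  Adj x y := x ≠ y ∧ ∃ d : G.E × Bool, P d.1 ∧ d.1 ≠ e ∧ G.dartBase d = x ∧ G.dartHead d = y
  symm := ⟨by
    rintro x y ⟨hxy, d, h1, h2, h3, h4⟩
    exact ⟨hxy.symm, G.dartFlip d, h1, h2, by rw [G.base_flip, h4], by rw [G.head_flip, h3]⟩⟩
  loopless := ⟨fun x h => h.1 rfl⟩

theorem MGraph.avoid_reachable (G : MGraph) (P : G.E → Prop) (e : G.E) (he : P e)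
    (hev : ∀ v, Even ((G.dartsAt v).filter (fun d => P d.1)).card) :
    (G.avoid P e).Reachable (G.tgt e) (G.src e) := by
  by_contra hna
  set H := G.avoid P e with hH
  let C : Finset G.V := Finset.univ.filter (fun v => H.Reachable (G.tgt e) v)
  let D : Finset (G.E × Bool) := Finset.univ.filter (fun d => P d.1 ∧ G.dartBase d ∈ C)
  have hD : Even D.card := by
    rw [Finset.card_eq_sum_card_fiberwise (f := G.dartBase) (t := C)
      (fun d hd => (Finset.mem_filter.1 hd).2.2)]
    refine Finset.even_sum _ ?_
    intro v hv
    have key : D.filter (fun d => G.dartBase d = v) =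
        (G.dartsAt v).filter (fun d => P d.1) := ?_
    · rw [key]; exact hev v
    ext d
    simp only [D, Finset.mem_filter, Finset.mem_univ, true_and, G.mem_dartsAt]
    constructor
    · rintro ⟨⟨h1, h2⟩, h3⟩; exact ⟨h3, h1⟩
    · rintro ⟨h1, h2⟩; exact ⟨⟨h2, h1 ▸ hv⟩, h1⟩
  have hmem : ((e, false) : G.E × Bool) ∈ D := by
    simp [D, C, he, MGraph.dartBase]
  have hE : Even (D.erase (e, false)).card := by
    apply G.even_card_of_flip
    intro d hd
    have hd2 := Finset.mem_erase.1 hd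
    have hd3 := (Finset.mem_filter.1 hd2.2).2
    have hr : H.Reachable (G.tgt e) (G.dartBase d) := (Finset.mem_filter.1 hd3.2).2
    have hne : d.1 ≠ e := by
      intro h
      rcases d with ⟨e', b⟩
      simp only at h
      subst h
      cases b
      · exact hd2.1 rfl
      · exact hna hr
    refine Finset.mem_erase.2 ⟨fun h => hne (congrArg Prod.fst h), ?_⟩
    refine Finset.mem_filter.2 ⟨Finset.mem_univ _, hd3.1, Finset.mem_filter.2 ⟨Finset.mem_univ _, ?_⟩⟩
    rw [G.base_flip]
    by_cases hb : G.dartBase d = G.dartHead d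
    · rw [← hb]; exact hr
    · exact hr.trans (SimpleGraph.Adj.reachable ⟨hb, d, hd3.1, hne, rfl, rfl⟩)
  rw [Finset.card_erase_of_mem hmem] at hE
  have hpos : 0 < D.card := Finset.card_pos.2 ⟨_, hmem⟩
  rcases hD with ⟨r, hr⟩
  rcases hE with ⟨s, hs⟩
  omega

theorem MGraph.cycle_through (G : MGraph) (P : G.E → Prop) (e : G.E) (he : P e)
    (hev : ∀ v, Even ((G.dartsAt v).filter (fun d => P d.1)).card) :
    SimpleCycleThroughE G P e := by
  obtain ⟨p, hp⟩ := (G.avoid_reachable P e he hev).exists_isPath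
  have hinj : ∀ i j, i ≤ p.length → j ≤ p.length → p.getVert i = p.getVert j → i = j :=
    fun i j hi hj h => hp.getVert_injOn hi hj h
  have hex : ∀ i, ∃ d : G.E × Bool, i < p.length →
      P d.1 ∧ d.1 ≠ e ∧ G.dartBase d = p.getVert i ∧ G.dartHead d = p.getVert (i+1) := by
    intro i
    by_cases hi : i < p.length
    · obtain ⟨_, d, hd⟩ := p.adj_getVert_succ hi
      exact ⟨d, fun _ => hd⟩
    · exact ⟨(e, true), fun h => absurd h hi⟩
  choose g hg using hex
  let F : ℕ → G.E × Bool := fun i => if i < p.length then g i else (e, true)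
  have hFlt : ∀ i, i < p.length → F i = g i := fun i hi => if_pos hi
  have hFl : F p.length = (e, true) := if_neg (lt_irrefl _)
  have hbase : ∀ i, i ≤ p.length → G.dartBase (F i) = p.getVert i := by
    intro i hi
    rcases hi.lt_or_eq with h | h
    · rw [hFlt i h]; exact (hg i h).2.2.1
    · rw [h, hFl, p.getVert_length]; rfl
  have hedge : ∀ i j, i < p.length → j < p.length → (g i).1 = (g j).1 → i = j := by
    intro i j hi hj h
    rcases G.eq_or_flip _ _ h with h | h
    · apply hinj i j hi.le hj.le
      rw [← (hg i hi).2.2.1, ← (hg j hj).2.2.1, h]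
    · have h1 : i = j + 1 := by
        apply hinj _ _ hi.le hj
        rw [← (hg i hi).2.2.1, ← (hg j hj).2.2.2, h, G.base_flip]
      have h2 : i + 1 = j := by
        apply hinj _ _ hi hj.le
        rw [← (hg i hi).2.2.2, ← (hg j hj).2.2.1, h, G.head_flip]
      omega
  refine ⟨p.length + 1, Nat.succ_pos _, fun i : Fin (p.length + 1) => F i.val, ?_, ?_, ?_, ?_, ?_⟩
  · intro (i : Fin (p.length + 1))
    show P (F i.val).1
    rcases (Nat.lt_succ_iff.1 i.2).lt_or_eq with h | h
    · rw [hFlt _ h]; exact (hg _ h).1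
    · rw [h, hFl]; exact he
  · intro (i : Fin (p.length + 1))
    show G.dartHead (F i.val) = G.dartBase (F (i + 1 : Fin (p.length + 1)).val)
    rcases (Nat.lt_succ_iff.1 i.2).lt_or_eq with h | h
    · have : (i + 1 : Fin (p.length + 1)).val = i.val + 1 :=
        Fin.val_add_one_of_lt (Fin.lt_def.2 (by simpa using h))
      rw [this, hbase _ h, hFlt _ h]; exact (hg _ h).2.2.2
    · have h' : i = Fin.last _ := Fin.ext h
      rw [h', Fin.last_add_one, hbase _ (by simp)]
      simp [hFl, MGraph.dartHead]
  · intro (i : Fin (p.length + 1)) (j : Fin (p.length + 1)) h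
    have h : G.dartBase (F i.val) = G.dartBase (F j.val) := h
    rw [hbase _ (Nat.lt_succ_iff.1 i.2), hbase _ (Nat.lt_succ_iff.1 j.2)] at h
    exact Fin.ext (hinj _ _ (Nat.lt_succ_iff.1 i.2) (Nat.lt_succ_iff.1 j.2) h)
  · intro (i : Fin (p.length + 1)) (j : Fin (p.length + 1)) h
    have h : (F i.val).1 = (F j.val).1 := h
    apply Fin.ext
    rcases (Nat.lt_succ_iff.1 i.2).lt_or_eq with hi | hi <;>
      rcases (Nat.lt_succ_iff.1 j.2).lt_or_eq with hj | hj
    · rw [hFlt _ hi, hFlt _ hj] at h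
      exact hedge _ _ hi hj h
    · rw [hFlt _ hi, hj, hFl] at h
      exact absurd h (hg _ hi).2.1
    · rw [hFlt _ hj, hi, hFl] at h
      exact absurd h.symm (hg _ hj).2.1
    · rw [hi, hj]
  · refine ⟨(Fin.last p.length : Fin (p.length + 1)), ?_⟩
    show (F (Fin.last p.length).val).1 = e
    rw [Fin.val_last, hFl]

namespace UnramDoubleCover

theorem map_base {Gt G : MGraph} (pi : UnramDoubleCover Gt G) (dt : Gt.E × Bool) :
    G.dartBase (pi.mapE dt.1, dt.2) = pi.mapV (Gt.dartBase dt) := by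
  rcases dt with ⟨e, b⟩
  cases b
  · exact pi.map_tgt e
  · exact pi.map_src e

theorem locdeg_eq {Gt G : MGraph} (pi : UnramDoubleCover Gt G) (vt : Gt.V) (dl : G.E × Bool)
    (h : G.dartBase dl = pi.mapV vt) :
    pi.locdeg vt = ∑ dt ∈ (Gt.dartsAt vt).filter
      (fun dt => pi.mapE dt.1 = dl.1 ∧ dt.2 = dl.2), pi.d dt.1 := by
  rw [pi.harmonic vt dl ((G.mem_dartsAt _ _).2 h)]

theorem d_le {Gt G : MGraph} (pi : UnramDoubleCover Gt G) (dt : Gt.E × Bool) :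
    pi.d dt.1 ≤ pi.locdeg (Gt.dartBase dt) := by
  rw [pi.locdeg_eq _ (pi.mapE dt.1, dt.2) (pi.map_base dt)]
  exact Finset.single_le_sum (f := fun dt : Gt.E × Bool => pi.d dt.1) (fun _ _ => Nat.zero_le _)
    (Finset.mem_filter.2 ⟨(Gt.mem_dartsAt _ _).2 rfl, rfl, rfl⟩)

theorem d_add_le {Gt G : MGraph} (pi : UnramDoubleCover Gt G) (dt dt' : Gt.E × Bool)
    (hne : dt ≠ dt') (hb : Gt.dartBase dt' = Gt.dartBase dt)
    (h1 : pi.mapE dt'.1 = pi.mapE dt.1) (h2 : dt'.2 = dt.2) :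
    pi.d dt.1 + pi.d dt'.1 ≤ pi.locdeg (Gt.dartBase dt) := by
  rw [pi.locdeg_eq _ (pi.mapE dt.1, dt.2) (pi.map_base dt)]
  rw [← Finset.sum_pair (f := fun dt : Gt.E × Bool => pi.d dt.1) hne]
  apply Finset.sum_le_sum_of_subset
  intro x hx
  simp only [Finset.mem_insert, Finset.mem_singleton] at hx
  rcases hx with rfl | rfl
  · exact Finset.mem_filter.2 ⟨(Gt.mem_dartsAt _ _).2 rfl, rfl, rfl⟩
  · exact Finset.mem_filter.2 ⟨(Gt.mem_dartsAt _ _).2 hb, h1, h2⟩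

theorem locdeg_add_le {Gt G : MGraph} (pi : UnramDoubleCover Gt G) (v w : Gt.V)
    (hne : v ≠ w) (h : pi.mapV w = pi.mapV v) : pi.locdeg v + pi.locdeg w ≤ 2 := by
  have := pi.deg_eq (pi.mapV v)
  rw [pi.deg_two] at this
  rw [this, ← Finset.sum_pair (f := pi.locdeg) hne]
  apply Finset.sum_le_sum_of_subset
  intro x hx
  simp only [Finset.mem_insert, Finset.mem_singleton] at hx
  rcases hx with rfl | rfl <;> simp [h]

theorem locdeg_le {Gt G : MGraph} (pi : UnramDoubleCover Gt G) (v : Gt.V) : pi.locdeg v ≤ 2 := by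
  have := pi.deg_eq (pi.mapV v)
  rw [pi.deg_two] at this
  rw [this]
  exact Finset.single_le_sum (f := pi.locdeg) (fun _ _ => Nat.zero_le _) (by simp)

theorem dilated_of_d {Gt G : MGraph} (pi : UnramDoubleCover Gt G) (et : Gt.E)
    (h : pi.d et = 2) : pi.IsDilatedE (pi.mapE et) := by
  refine ⟨et, rfl, h, ?_⟩
  intro et' he
  by_contra hne
  have h1 : 2 ≤ pi.locdeg (Gt.src et) := h ▸ pi.d_le (et, true)
  have h2 : pi.d et' ≤ pi.locdeg (Gt.src et') := pi.d_le (et', true)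
  have hp := pi.d_pos et'
  by_cases hs : Gt.src et = Gt.src et'
  · have h3 : pi.d et + pi.d et' ≤ pi.locdeg (Gt.src et) :=
      pi.d_add_le (et, true) (et', true) (fun h => hne (congrArg Prod.fst h).symm)
        hs.symm he rfl
    have := pi.locdeg_le (Gt.src et)
    omega
  · have := pi.locdeg_add_le _ _ hs (by rw [← pi.map_src, ← pi.map_src, he])
    omega

theorem even_at {Gt G : MGraph} (pi : UnramDoubleCover Gt G) (vt : Gt.V)
    (h : pi.locdeg vt = 2) :
    Even ((G.dartsAt (pi.mapV vt)).filter (fun dl => pi.IsDilatedE dl.1)).card := by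
  have hun := pi.unramified vt
  have hcard : ((G.dartsAt (pi.mapV vt)).filter (fun dl => pi.IsDilatedE dl.1)).card =
      ((Gt.dartsAt vt).filter (fun dt => pi.d dt.1 = 2)).card := by
    symm
    refine Finset.card_bij (fun dt _ => (pi.mapE dt.1, dt.2)) ?_ ?_ ?_
    · intro dt hdt
      simp only [Finset.mem_filter, MGraph.mem_dartsAt] at hdt ⊢
      exact ⟨by rw [pi.map_base, hdt.1], pi.dilated_of_d _ hdt.2⟩
    · intro dt hdt dt' hdt' heq
      simp only [Finset.mem_filter, MGraph.mem_dartsAt] at hdt hdt'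
      obtain ⟨et, -, -, hu⟩ := pi.dilated_of_d _ hdt.2
      have e1 := hu dt.1 rfl
      have e2 := hu dt'.1 (congrArg Prod.fst heq).symm
      exact Prod.ext (e1.trans e2.symm) (Prod.ext_iff.1 heq).2
    · intro dl hdl
      simp only [Finset.mem_filter, MGraph.mem_dartsAt] at hdl
      have hl := pi.locdeg_eq vt dl hdl.1
      obtain ⟨et, h1, h2, hu⟩ := hdl.2
      have hne : ((Gt.dartsAt vt).filter
          (fun dt => pi.mapE dt.1 = dl.1 ∧ dt.2 = dl.2)).Nonempty := by
        rw [Finset.nonempty_iff_ne_empty]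
        intro h0
        rw [h0, Finset.sum_empty] at hl
        omega
      obtain ⟨dt, hdt⟩ := hne
      obtain ⟨hdt, h3, h4⟩ := Finset.mem_filter.1 hdt
      refine ⟨dt, Finset.mem_filter.2 ⟨hdt, ?_⟩, Prod.ext h3 h4⟩
      rw [hu _ h3, h2]
  have hsum : ∑ dt ∈ Gt.dartsAt vt, ((pi.d dt.1 : ℤ) - 1) =
      (((Gt.dartsAt vt).filter (fun dt => pi.d dt.1 = 2)).card : ℤ) := by
    rw [Finset.card_filter, Nat.cast_sum]
    refine Finset.sum_congr rfl ?_
    intro dt hdt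
    have hb := (Gt.mem_dartsAt _ _).1 hdt
    have h1 := pi.d_le dt
    rw [hb, h] at h1
    have h2 := pi.d_pos dt.1
    split_ifs with h3
    · rw [h3]; norm_num
    · have : pi.d dt.1 = 1 := by omega
      rw [this]; norm_num
  rw [hcard, ← Int.even_coe_nat, ← hsum]
  rw [h] at hun
  refine ⟨(2 - 2 * (pi.gw (pi.mapV vt) : ℤ)) - (1 - (pi.gwt vt : ℤ)), ?_⟩
  push_cast at hun
  linarith

theorem even_all {Gt G : MGraph} (pi : UnramDoubleCover Gt G) (v : G.V) :
    Even ((G.dartsAt v).filter (fun dl => pi.IsDilatedE dl.1)).card := by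
  rcases Finset.eq_empty_or_nonempty ((G.dartsAt v).filter (fun dl => pi.IsDilatedE dl.1))
    with h0 | ⟨dl, hdl⟩
  · rw [h0]; simp
  · obtain ⟨h1, et, h2, h3, -⟩ := Finset.mem_filter.1 hdl
    have hb := pi.map_base (et, dl.2)
    have hb' : v = pi.mapV (Gt.dartBase (et, dl.2)) := by
      rw [← hb, ← (G.mem_dartsAt _ _).1 h1]
      simp only [h2]
    rw [hb']
    apply pi.even_at
    have := pi.d_le (et, dl.2)
    have := pi.locdeg_le (Gt.dartBase (et, dl.2))
    simp only at *
    omega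

end UnramDoubleCover

/-!
Statement 5: the dilation cycle of an unramified double cover of tropical curves
is a union of cycles and isolated points: at every point `p` of the dilation
cycle the number of edges of the dilation cycle emanating from `p` is even, so
`p` is either an isolated point of the dilation cycle or lies on a cycle
contained entirely in the dilation cycle (and every dilated edge lies on such a
cycle).
-/

theorem dilation_cycle_is_union_of_cycles_and_isolated_points
    (Gt G : MGraph) (pi : UnramDoubleCover Gt G) :
    (∀ v : G.V, pi.IsDilatedV v →
      Even ((G.dartsAt v).filter (fun dl => pi.IsDilatedE dl.1)).card ∧
      (((G.dartsAt v).filter (fun dl => pi.IsDilatedE dl.1)).card = 0 ∨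
        SimpleCycleThroughV G pi.IsDilatedE v)) ∧
    (∀ e : G.E, pi.IsDilatedE e → SimpleCycleThroughE G pi.IsDilatedE e) := by
  have hE : ∀ e : G.E, pi.IsDilatedE e → SimpleCycleThroughE G pi.IsDilatedE e :=
    fun e he => G.cycle_through _ e he pi.even_all
  refine ⟨fun v _ => ⟨pi.even_all v, ?_⟩, hE⟩
  rcases Finset.eq_empty_or_nonempty ((G.dartsAt v).filter (fun dl => pi.IsDilatedE dl.1))
    with h0 | ⟨dl, hdl⟩
  · left; rw [h0]; simp
  · right
    obtain ⟨h1, h2⟩ := Finset.mem_filter.1 hdl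
    obtain ⟨n, hn, f, a1, a2, a3, a4, i, hi⟩ := hE _ h2
    refine ⟨n, hn, f, a1, a2, a3, a4, ?_⟩
    have hv := (G.mem_dartsAt _ _).1 h1
    rcases G.eq_or_flip _ _ hi with h | h
    · exact ⟨i, by rw [h, hv]⟩
    · exact ⟨i + 1, by rw [← a2, h, G.head_flip, hv]⟩
end

section
/- Let Γ be a chain of g loops with the final bridge and vertex removed (loops γ₁,…,γ_g with tail vertices v_i and head vertices w_i, lower arcs of length m_i = 1, and an extra vertex w₀ joined to v₁). Let D be a divisor of degree 2g−2 on Γ such that D + w₀ is effective, deg(D|_{γ_i}) = 2 for 1 ≤ i < g, and deg(D|_{γ_g}) = 1. Then D is linearly equivalent to the canonical divisor K_Γ if and only if for each 1 ≤ i ≤ g−1 one has D|_{γ_i} = p_i + q_i, where the counterclockwise distance of p_i from v_i equals the clockwise distance of q_i from w_i, and D|_{γ_g} is the vertex of the last loop γ_g. -/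
open scoped Classical

/-! ### Rational functions, divisors, linear equivalence, and Baker–Norine rank
on a metric graph -/

namespace MGraph

/-- The points of the metric graph: vertices and interior points of edges. -/
def Pt (G : MGraph) : Type :=
  G.V ⊕ (Σ e : G.E, {t : ℝ // 0 < t ∧ t < G.len e})

/-- The function induced on (the closed interval corresponding to) an edge by a
function on the points of the graph. -/
noncomputable def onEdge (G : MGraph) (f : G.Pt → ℝ) (e : G.E) (t : ℝ) : ℝ :=
  if h : 0 < t ∧ t < G.len e then f (Sum.inr ⟨e, ⟨t, h⟩⟩)
  else if t ≤ 0 then f (Sum.inl (G.src e)) else f (Sum.inl (G.tgt e))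

/-- A continuous piecewise linear function with integer slopes on `[0, L]`. -/
def IntPL (L : ℝ) (g : ℝ → ℝ) : Prop :=
  ∃ (n : ℕ) (x : ℕ → ℝ) (s : ℕ → ℤ),
    x 0 = 0 ∧ x n = L ∧ (∀ i < n, x i < x (i + 1)) ∧
    ∀ i < n, ∀ t : ℝ, x i ≤ t → t ≤ x (i + 1) →
      g t = g (x i) + (s i : ℝ) * (t - x i)

/-- A rational function on the metric graph: continuous piecewise linear with
integer slopes on every edge. -/
def IsRationalFn (G : MGraph) (f : G.Pt → ℝ) : Prop :=
  ∀ e : G.E, IntPL (G.len e) (G.onEdge f e)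

/-- `g` has outgoing slope `s` at `a` in the increasing direction. -/
def HasRightSlope (g : ℝ → ℝ) (a : ℝ) (s : ℤ) : Prop :=
  ∃ ε > 0, ∀ u : ℝ, 0 < u → u < ε → g (a + u) = g a + (s : ℝ) * u

/-- `g` has outgoing slope `s` at `a` in the decreasing direction. -/
def HasLeftSlope (g : ℝ → ℝ) (a : ℝ) (s : ℤ) : Prop :=
  ∃ ε > 0, ∀ u : ℝ, 0 < u → u < ε → g (a - u) = g a + (s : ℝ) * u

/-- Divisors on the metric graph. -/
abbrev DivT (G : MGraph) : Type := G.Pt →₀ ℤ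

/-- The degree of a divisor. -/
noncomputable def degD (G : MGraph) (D : G.DivT) : ℤ := D.sum fun _ n => n

/-- An effective divisor. -/
def EffectiveD (G : MGraph) (D : G.DivT) : Prop := ∀ p, 0 ≤ D p

/-- `D = div(f)`: at every point, the coefficient of `D` is the sum of the
outgoing slopes of the rational function `f`. -/
noncomputable def IsDivisorOf (G : MGraph) (f : G.Pt → ℝ) (D : G.DivT) : Prop :=
  G.IsRationalFn f ∧
  (∀ (e : G.E) (t : ℝ) (h : 0 < t ∧ t < G.len e),
    ∃ s₁ s₂ : ℤ, HasRightSlope (G.onEdge f e) t s₁ ∧ HasLeftSlope (G.onEdge f e) t s₂ ∧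
      D (Sum.inr ⟨e, ⟨t, h⟩⟩) = s₁ + s₂) ∧
  (∀ v : G.V, ∃ s : G.E × Bool → ℤ,
    (∀ dl ∈ G.dartsAt v,
      if dl.2 then HasRightSlope (G.onEdge f dl.1) 0 (s dl)
      else HasLeftSlope (G.onEdge f dl.1) (G.len dl.1) (s dl)) ∧
    D (Sum.inl v) = ∑ dl ∈ G.dartsAt v, s dl)

/-- Linear equivalence of divisors. -/
noncomputable def LinEq (G : MGraph) (D D' : G.DivT) : Prop :=
  ∃ f : G.Pt → ℝ, G.IsDivisorOf f (D - D')

/-- The Baker–Norine rank of a divisor. -/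
noncomputable def bnRank (G : MGraph) (D : G.DivT) : ℤ :=
  sSup {r : ℤ | r = -1 ∨ (0 ≤ r ∧ ∀ E : G.DivT, G.EffectiveD E → G.degD E = r →
    ∃ F : G.DivT, G.EffectiveD F ∧ G.LinEq (D - E) F)}

end MGraph

/-!
Statement 10: characterization of the divisors equivalent to the canonical
divisor on a chain of `g` loops with the final bridge and vertex removed.

The base graph `Γ` has loops `γ_1, …, γ_{g-1}` with tail vertices `v_i` and head
vertices `w_i`, upper arcs of lengths `ℓ_i` and lower arcs of length `1`, bridges
`w_{i-1} → v_i` (with an extra vertex `w₀` joined to `v_1`), and a final loop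
`γ_g` which is a circle of circumference `c` through the single vertex `v_g`.
-/

/-- Length data of the base chain of loops. -/
structure BaseChainData (g : ℕ) where
  hg : 2 ≤ g
  up : ℕ → ℝ
  c : ℝ
  bri : ℕ → ℝ
  up_pos : ∀ i, 0 < up i
  c_pos : 0 < c
  bri_pos : ∀ i, 0 < bri i

namespace BaseChainData

variable {g : ℕ} (B : BaseChainData g)

/-- The base chain of loops `Γ` (with the final bridge and vertex removed):
vertices `v_0, …, v_{g-1}`, `w_0, …, w_{g-2}` (0-indexed) and the extra
vertex `w₋ = w₀` of the paper; edges: upper and lower arcs of the first `g-1`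
loops, the bridges, and the final loop edge at `v_{g-1}`. -/
noncomputable def graph : MGraph where
  V := (Fin g ⊕ Fin (g - 1)) ⊕ Unit
  E := (Fin (g - 1) ⊕ Fin (g - 1)) ⊕ (Fin g ⊕ Unit)
  src := fun e => match e with
    | Sum.inl (Sum.inl i) => Sum.inl (Sum.inl ⟨i.val, by have := i.isLt; omega⟩)
    | Sum.inl (Sum.inr i) => Sum.inl (Sum.inl ⟨i.val, by have := i.isLt; omega⟩)
    | Sum.inr (Sum.inl i) =>
        if h : i.val = 0 then Sum.inr ()
        else Sum.inl (Sum.inr ⟨i.val - 1, by have := i.isLt; omega⟩)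
    | Sum.inr (Sum.inr _) => Sum.inl (Sum.inl ⟨g - 1, by have := B.hg; omega⟩)
  tgt := fun e => match e with
    | Sum.inl (Sum.inl i) => Sum.inl (Sum.inr i)
    | Sum.inl (Sum.inr i) => Sum.inl (Sum.inr i)
    | Sum.inr (Sum.inl i) => Sum.inl (Sum.inl i)
    | Sum.inr (Sum.inr _) => Sum.inl (Sum.inl ⟨g - 1, by have := B.hg; omega⟩)
  len := fun e => match e with
    | Sum.inl (Sum.inl i) => B.up i.val
    | Sum.inl (Sum.inr i) => 1
    | Sum.inr (Sum.inl i) => B.bri i.val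
    | Sum.inr (Sum.inr _) => B.c
  len_pos := fun e => match e with
    | Sum.inl (Sum.inl i) => B.up_pos i.val
    | Sum.inl (Sum.inr i) => one_pos
    | Sum.inr (Sum.inl i) => B.bri_pos i.val
    | Sum.inr (Sum.inr _) => B.c_pos

/-- The tail vertex `v_i` as a point. -/
noncomputable def vPt (i : Fin g) : B.graph.Pt := Sum.inl (Sum.inl (Sum.inl i))

/-- The head vertex `w_i` as a point. -/
noncomputable def wPt (i : Fin (g - 1)) : B.graph.Pt := Sum.inl (Sum.inl (Sum.inr i))

/-- The extra vertex `w₀` as a point. -/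
noncomputable def w0Pt : B.graph.Pt := Sum.inl (Sum.inr ())

/-- The vertex `v_g` of the last loop, as a point. -/
noncomputable def vLastPt : B.graph.Pt :=
  Sum.inl (Sum.inl (Sum.inl ⟨g - 1, by have := B.hg; omega⟩))

/-- The canonical divisor `K_Γ = ∑_p (val(p) - 2)·p`. -/
noncomputable def KDiv : B.graph.DivT :=
  Finsupp.single B.w0Pt (-1)
    + (∑ i : Fin (g - 1),
        (Finsupp.single (B.vPt ⟨i.val, by have := i.isLt; omega⟩) 1
          + Finsupp.single (B.wPt i) 1))
    + Finsupp.single B.vLastPt 1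

/-- The points of the `i`-th loop `γ_{i+1}` (`i = 0, …, g-2`): its two vertices
and the interiors of its two arcs. -/
noncomputable def onLoop (i : Fin (g - 1)) (p : B.graph.Pt) : Prop :=
  match p with
  | Sum.inl (Sum.inl (Sum.inl j)) => (j : ℕ) = (i : ℕ)
  | Sum.inl (Sum.inl (Sum.inr j)) => (j : ℕ) = (i : ℕ)
  | Sum.inl (Sum.inr _) => False
  | Sum.inr q =>
    match q.1 with
    | Sum.inl (Sum.inl j) => (j : ℕ) = (i : ℕ)
    | Sum.inl (Sum.inr j) => (j : ℕ) = (i : ℕ)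
    | _ => False

/-- The points of the last loop `γ_g`: its vertex and the interior of the loop
edge. -/
noncomputable def onLastLoop (p : B.graph.Pt) : Prop :=
  match p with
  | Sum.inl (Sum.inl (Sum.inl j)) => (j : ℕ) = g - 1
  | Sum.inr q =>
    match q.1 with
    | Sum.inr (Sum.inr _) => True
    | _ => False
  | _ => False

/-- The counterclockwise position of a point of the `i`-th loop, measured from
the tail vertex `v_i` (counterclockwise runs along the upper arc from `v_i` to
`w_i`, then back along the lower arc). -/
noncomputable def loopPos (i : Fin (g - 1)) (p : B.graph.Pt) : ℝ :=
  match p with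
  | Sum.inl (Sum.inl (Sum.inl _)) => 0
  | Sum.inl (Sum.inl (Sum.inr _)) => B.up i.val
  | Sum.inr q =>
    match q with
    | ⟨Sum.inl (Sum.inl _), t⟩ => t.1
    | ⟨Sum.inl (Sum.inr _), t⟩ => (B.up i.val + 1) - t.1
    | _ => 0
  | _ => 0

/-- The degree of the restriction of a divisor to a set of points. -/
noncomputable def degOn (D : B.graph.DivT) (P : B.graph.Pt → Prop) : ℤ :=
  D.sum fun p n => if P p then n else 0

end BaseChainData

/-! ### Generic lemmas on slopes -/

theorem real_ind (L : ℝ) (P : ℝ → Prop) (h0 : P 0)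
    (hr : ∀ x, 0 ≤ x → x < L → (∀ u, 0 ≤ u → u ≤ x → P u) →
      ∃ ε > 0, ∀ u, 0 < u → u < ε → P (x + u))
    (hl : ∀ x, 0 < x → x ≤ L → (∀ u, 0 ≤ u → u < x → P u) → P x) :
    ∀ x, 0 ≤ x → x ≤ L → P x := by
  intro x hx0 hxL
  let S : Set ℝ := {t | ∀ u, 0 ≤ u → u ≤ t → P u}
  have hclosed : IsClosed (S ∩ Set.Icc 0 L) := by
    apply isClosed_of_closure_subset
    intro y hy
    have hyI : y ∈ Set.Icc (0 : ℝ) L :=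
      closure_minimal Set.inter_subset_right isClosed_Icc hy
    refine ⟨?_, hyI⟩
    have hlt : ∀ u, 0 ≤ u → u < y → P u := by
      intro u hu huy
      obtain ⟨z, hz1, hz2⟩ := mem_closure_iff.1 hy (Set.Ioi u) isOpen_Ioi huy
      exact hz2.1 u hu (le_of_lt hz1)
    intro u hu huy
    rcases lt_or_eq_of_le huy with h | h
    · exact hlt u hu h
    · subst h
      rcases lt_or_eq_of_le hu with h | h
      · exact hl u h hyI.2 hlt
      · rw [← h]; exact h0
  have hsub : Set.Icc 0 L ⊆ S := by
    apply hclosed.Icc_subset_of_forall_exists_gt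
    · intro u hu hu'
      have : u = 0 := le_antisymm hu' hu
      rw [this]; exact h0
    · rintro y ⟨hyS, hy0, hyL⟩ z hz
      obtain ⟨ε, hε, hP⟩ := hr y hy0 hyL hyS
      have hz' : y < z := hz
      have hm : 0 < min (ε / 2) (z - y) := lt_min (by linarith) (by linarith)
      refine ⟨y + min (ε / 2) (z - y), ?_, ?_, ?_⟩
      · intro u hu hu'
        rcases le_or_gt u y with h | h
        · exact hyS u hu h
        · have := hP (u - y) (by linarith) (by linarith [min_le_left (ε / 2) (z - y)])
          simpa using this
      · linarith
      · linarith [min_le_right (ε / 2) (z - y)]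
  exact hsub ⟨hx0, hxL⟩ x hx0 le_rfl

namespace MGraph

theorem HasRightSlope.add {f h : ℝ → ℝ} {a : ℝ} {s r : ℤ} (hf : HasRightSlope f a s)
    (hh : HasRightSlope h a r) : HasRightSlope (fun t => f t + h t) a (s + r) := by
  obtain ⟨ε, hε, H⟩ := hf
  obtain ⟨δ, hδ, H'⟩ := hh
  refine ⟨min ε δ, lt_min hε hδ, fun u hu hu' => ?_⟩
  simp only [H u hu (hu'.trans_le (min_le_left _ _)), H' u hu (hu'.trans_le (min_le_right _ _))]
  push_cast; ring

theorem HasLeftSlope.add {f h : ℝ → ℝ} {a : ℝ} {s r : ℤ} (hf : HasLeftSlope f a s)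
    (hh : HasLeftSlope h a r) : HasLeftSlope (fun t => f t + h t) a (s + r) := by
  obtain ⟨ε, hε, H⟩ := hf
  obtain ⟨δ, hδ, H'⟩ := hh
  refine ⟨min ε δ, lt_min hε hδ, fun u hu hu' => ?_⟩
  simp only [H u hu (hu'.trans_le (min_le_left _ _)), H' u hu (hu'.trans_le (min_le_right _ _))]
  push_cast; ring

theorem HasRightSlope.mul {f : ℝ → ℝ} {a : ℝ} {s : ℤ} (hf : HasRightSlope f a s) (n : ℤ) :
    HasRightSlope (fun t => n * f t) a (n * s) := by
  obtain ⟨ε, hε, H⟩ := hf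
  refine ⟨ε, hε, fun u hu hu' => ?_⟩
  simp only [H u hu hu']
  push_cast; ring

theorem HasLeftSlope.mul {f : ℝ → ℝ} {a : ℝ} {s : ℤ} (hf : HasLeftSlope f a s) (n : ℤ) :
    HasLeftSlope (fun t => n * f t) a (n * s) := by
  obtain ⟨ε, hε, H⟩ := hf
  refine ⟨ε, hε, fun u hu hu' => ?_⟩
  simp only [H u hu hu']
  push_cast; ring

theorem HasRightSlope.sum {ι : Type*} (T : Finset ι) {f : ι → ℝ → ℝ} {a : ℝ} {s : ι → ℤ}
    (hf : ∀ i ∈ T, HasRightSlope (f i) a (s i)) :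
    HasRightSlope (fun t => ∑ i ∈ T, f i t) a (∑ i ∈ T, s i) := by
  induction T using Finset.induction_on with
  | empty => exact ⟨1, one_pos, fun u _ _ => by simp⟩
  | insert i T hi ih =>
    simp only [Finset.sum_insert hi]
    exact (hf i (by simp)).add (ih fun j hj => hf j (by simp [hj]))

theorem HasLeftSlope.sum {ι : Type*} (T : Finset ι) {f : ι → ℝ → ℝ} {a : ℝ} {s : ι → ℤ}
    (hf : ∀ i ∈ T, HasLeftSlope (f i) a (s i)) :
    HasLeftSlope (fun t => ∑ i ∈ T, f i t) a (∑ i ∈ T, s i) := by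
  induction T using Finset.induction_on with
  | empty => exact ⟨1, one_pos, fun u _ _ => by simp⟩
  | insert i T hi ih =>
    simp only [Finset.sum_insert hi]
    exact (hf i (by simp)).add (ih fun j hj => hf j (by simp [hj]))

theorem HasRightSlope.congr {f h : ℝ → ℝ} {a : ℝ} {s : ℤ} (hf : HasRightSlope f a s)
    (b : ℝ) (hb : a < b) (H : ∀ t, a ≤ t → t < b → h t = f t) : HasRightSlope h a s := by
  obtain ⟨ε, hε, H'⟩ := hf
  refine ⟨min ε (b - a), lt_min hε (by linarith), fun u hu hu' => ?_⟩
  have h1 := hu'.trans_le (min_le_left _ _)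
  have h2 := hu'.trans_le (min_le_right _ _)
  rw [H _ (by linarith) (by linarith), H _ le_rfl hb, H' u hu h1]

theorem HasLeftSlope.congr {f h : ℝ → ℝ} {a : ℝ} {s : ℤ} (hf : HasLeftSlope f a s)
    (b : ℝ) (hb : b < a) (H : ∀ t, b < t → t ≤ a → h t = f t) : HasLeftSlope h a s := by
  obtain ⟨ε, hε, H'⟩ := hf
  refine ⟨min ε (a - b), lt_min hε (by linarith), fun u hu hu' => ?_⟩
  have h1 := hu'.trans_le (min_le_left _ _)
  have h2 := hu'.trans_le (min_le_right _ _)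
  rw [H _ (by linarith) (by linarith), H _ hb le_rfl, H' u hu h1]

theorem HasLeftSlope.eq_zero {f : ℝ → ℝ} {a b c : ℝ} {s : ℤ} (hf : HasLeftSlope f a s)
    (hb : b < a) (H : ∀ t, b ≤ t → t < a → f t = c) : s = 0 ∧ f a = c := by
  obtain ⟨ε, hε, H'⟩ := hf
  have hm : 0 < min ε (a - b) := lt_min hε (by linarith)
  have h1 := min_le_left ε (a - b)
  have h2 := min_le_right ε (a - b)
  set m := min ε (a - b)
  have e1 := H' (m / 2) (by linarith) (by linarith)
  have e2 := H' (m / 4) (by linarith) (by linarith)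
  rw [H _ (by linarith) (by linarith)] at e1 e2
  have : (s : ℝ) * (m / 4) = 0 := by linarith
  have hs : (s : ℝ) = 0 := by
    rcases mul_eq_zero.1 this with h | h
    · exact h
    · linarith
  refine ⟨by exact_mod_cast hs, ?_⟩
  rw [hs] at e1; linarith

theorem HasRightSlope.unique {f : ℝ → ℝ} {a : ℝ} {s r : ℤ} (hf : HasRightSlope f a s)
    (hh : HasRightSlope f a r) : s = r := by
  obtain ⟨ε, hε, H⟩ := hf
  obtain ⟨δ, hδ, H'⟩ := hh
  have hm : 0 < min ε δ := lt_min hε hδ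
  have h1 := min_le_left ε δ
  have h2 := min_le_right ε δ
  set m := min ε δ
  have e1 := H (m / 2) (by linarith) (by linarith)
  have e2 := H' (m / 2) (by linarith) (by linarith)
  have : (s : ℝ) = r := by
    apply mul_right_cancel₀ (b := m / 2) (by linarith)
    linarith
  exact_mod_cast this

theorem HasLeftSlope.unique {f : ℝ → ℝ} {a : ℝ} {s r : ℤ} (hf : HasLeftSlope f a s)
    (hh : HasLeftSlope f a r) : s = r := by
  obtain ⟨ε, hε, H⟩ := hf
  obtain ⟨δ, hδ, H'⟩ := hh
  have hm : 0 < min ε δ := lt_min hε hδ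
  have h1 := min_le_left ε δ
  have h2 := min_le_right ε δ
  set m := min ε δ
  have e1 := H (m / 2) (by linarith) (by linarith)
  have e2 := H' (m / 2) (by linarith) (by linarith)
  have : (s : ℝ) = r := by
    apply mul_right_cancel₀ (b := m / 2) (by linarith)
    linarith
  exact_mod_cast this

theorem const_of_slopes (L : ℝ) (k : ℝ → ℝ) (h0 : HasRightSlope k 0 0)
    (hint : ∀ t, 0 < t → t < L → ∃ s r : ℤ, HasRightSlope k t s ∧ HasLeftSlope k t r ∧ s + r = 0)
    (hL : ∃ s : ℤ, HasLeftSlope k L s) : ∀ t, 0 ≤ t → t ≤ L → k t = k 0 := by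
  apply real_ind
  · rfl
  · intro x hx hxL H
    have hs : HasRightSlope k x 0 := by
      rcases lt_or_eq_of_le hx with h | h
      · obtain ⟨s, r, h1, h2, h3⟩ := hint x h hxL
        have := (h2.eq_zero h (fun t ht ht' => H t ht ht'.le)).1
        have : s = 0 := by omega
        rwa [this] at h1
      · rwa [← h]
    obtain ⟨ε, hε, H'⟩ := hs
    refine ⟨ε, hε, fun u hu hu' => ?_⟩
    rw [H' u hu hu', H x hx le_rfl]; simp
  · intro x hx hxL H
    have : ∃ r : ℤ, HasLeftSlope k x r := by
      rcases lt_or_eq_of_le hxL with h | h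
      · obtain ⟨s, r, _, h2, _⟩ := hint x hx h
        exact ⟨r, h2⟩
      · rwa [h]
    obtain ⟨r, hr⟩ := this
    exact (hr.eq_zero hx H).2

theorem IntPL.append {a b : ℝ} {k : ℝ → ℝ} (h : IntPL a k) (hab : a < b) (s : ℤ)
    (H : ∀ t, a ≤ t → t ≤ b → k t = k a + s * (t - a)) : IntPL b k := by
  obtain ⟨n, x, σ, hx0, hxn, hlt, hk⟩ := h
  refine ⟨n + 1, fun i => if i ≤ n then x i else b, fun i => if i < n then σ i else s,
    by simp [hx0], by simp, ?_, ?_⟩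
  · intro i hi
    rcases Nat.lt_succ_iff_lt_or_eq.1 hi with h | h
    · have h1 : i ≤ n := h.le
      have h2 : i + 1 ≤ n := h
      simp only [h1, h2, if_true]; exact hlt i h
    · subst h; simp [hxn, hab]
  · intro i hi t
    rcases Nat.lt_succ_iff_lt_or_eq.1 hi with h | h
    · have h1 : i ≤ n := h.le
      have h2 : i + 1 ≤ n := h
      simp only [h1, h2, h, if_true]; exact hk i h t
    · subst h
      simp only [le_refl, if_true, hxn, Nat.not_succ_le_self, if_false, lt_irrefl]
      exact H t

theorem intPL_of_slopes (L : ℝ) (hLpos : 0 < L) (k : ℝ → ℝ)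
    (hr : ∀ t, 0 ≤ t → t < L → ∃ s : ℤ, HasRightSlope k t s)
    (hl : ∀ t, 0 < t → t ≤ L → ∃ s : ℤ, HasLeftSlope k t s) : IntPL L k := by
  refine real_ind L (fun t => IntPL t k) ?_ ?_ ?_ L hLpos.le le_rfl
  · exact ⟨0, fun _ => 0, fun _ => 0, rfl, rfl, by simp, by simp⟩
  · intro x hx hxL H
    obtain ⟨s, ε, hε, hs⟩ := hr x hx hxL
    refine ⟨ε, hε, fun u hu hu' => (H x hx le_rfl).append (by linarith) s ?_⟩
    intro t ht ht'
    rcases lt_or_eq_of_le ht with h | h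
    · have := hs (t - x) (by linarith) (by linarith)
      simpa using this
    · simp [h]
  · intro x hx hxL H
    obtain ⟨s, ε, hε, hs⟩ := hl x hx hxL
    have hm : 0 < min (ε / 2) x := lt_min (by linarith) hx
    have h1 := min_le_left (ε / 2) x
    have h2 := min_le_right (ε / 2) x
    set m := min (ε / 2) x
    refine (H (x - m) (by linarith) (by linarith)).append (by linarith) (-s) ?_
    intro t ht ht'
    have e1 := hs m hm (by linarith)
    rw [e1]
    rcases lt_or_eq_of_le ht' with h | h
    · have := hs (x - t) (by linarith) (by linarith)
      rw [show x - (x - t) = t by ring] at this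
      rw [this]; push_cast; ring
    · rw [h]; push_cast; ring

end MGraph

/-! ### Divisors of rational functions in terms of slopes and vertex values -/

namespace MGraph

/-- indicator of the interior of the edge `e` -/
noncomputable def onE (G : MGraph) (e : G.E) (p : G.Pt) : ℤ :=
  match p with
  | Sum.inl _ => 0
  | Sum.inr q => if q.1 = e then 1 else 0

/-- the ramp function along the edge `e` with breakpoint `p` -/
noncomputable def rmp (G : MGraph) (e : G.E) (p : G.Pt) (t : ℝ) : ℝ :=
  match p with
  | Sum.inl _ => 0
  | Sum.inr q => if q.1 = e then max (t - q.2.1) 0 else 0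

noncomputable def rsl (G : MGraph) (e : G.E) (p : G.Pt) (t : ℝ) : ℤ :=
  match p with
  | Sum.inl _ => 0
  | Sum.inr q => if q.1 = e ∧ q.2.1 ≤ t then 1 else 0

noncomputable def lsl (G : MGraph) (e : G.E) (p : G.Pt) (t : ℝ) : ℤ :=
  match p with
  | Sum.inl _ => 0
  | Sum.inr q => if q.1 = e ∧ q.2.1 < t then -1 else 0

noncomputable def phi (G : MGraph) (Δ : G.DivT) (a : ℤ) (e : G.E) (t : ℝ) : ℝ :=
  a * t + ∑ p ∈ Δ.support, (Δ p : ℝ) * G.rmp e p t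

noncomputable def sdeg (G : MGraph) (Δ : G.DivT) (e : G.E) : ℤ :=
  ∑ p ∈ Δ.support, Δ p * G.onE e p

noncomputable def rval (G : MGraph) (Δ : G.DivT) (e : G.E) : ℝ :=
  ∑ p ∈ Δ.support, (Δ p : ℝ) * G.rmp e p (G.len e)

variable (G : MGraph)

theorem rmp_right (e : G.E) (p : G.Pt) (t : ℝ) :
    HasRightSlope (G.rmp e p) t (G.rsl e p t) := by
  rcases p with v | q
  · exact ⟨1, one_pos, fun u _ _ => by simp [rmp, rsl]⟩
  · by_cases he : q.1 = e
    · by_cases ht : q.2.1 ≤ t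
      · refine ⟨1, one_pos, fun u hu _ => ?_⟩
        simp only [rmp, rsl, he, ht, and_self, if_true]
        rw [max_eq_left (by linarith), max_eq_left (by linarith)]; push_cast; ring
      · push Not at ht
        refine ⟨q.2.1 - t, by linarith, fun u hu hu' => ?_⟩
        simp only [rmp, rsl, he, not_le.2 ht, and_false, if_true, if_false]
        rw [max_eq_right (by linarith), max_eq_right (by linarith)]; simp
    · exact ⟨1, one_pos, fun u _ _ => by simp [rmp, rsl, he]⟩

theorem rmp_left (e : G.E) (p : G.Pt) (t : ℝ) :
    HasLeftSlope (G.rmp e p) t (G.lsl e p t) := by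
  rcases p with v | q
  · exact ⟨1, one_pos, fun u _ _ => by simp [rmp, lsl]⟩
  · by_cases he : q.1 = e
    · by_cases ht : q.2.1 < t
      · refine ⟨t - q.2.1, by linarith, fun u hu hu' => ?_⟩
        simp only [rmp, lsl, he, ht, and_self, if_true]
        rw [max_eq_left (by linarith), max_eq_left (by linarith)]; push_cast; ring
      · push Not at ht
        refine ⟨1, one_pos, fun u hu hu' => ?_⟩
        simp only [rmp, lsl, he, not_lt.2 ht, and_false, if_true, if_false]
        rw [max_eq_right (by linarith), max_eq_right (by linarith)]; simp
    · exact ⟨1, one_pos, fun u _ _ => by simp [rmp, lsl, he]⟩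

theorem lin_right (a : ℤ) (t : ℝ) : HasRightSlope (fun t => a * t) t a :=
  ⟨1, one_pos, fun u _ _ => by ring⟩

theorem lin_left (a : ℤ) (t : ℝ) : HasLeftSlope (fun t => a * t) t (-a) :=
  ⟨1, one_pos, fun u _ _ => by push_cast; ring⟩

theorem const_right (c : ℝ) (t : ℝ) : HasRightSlope (fun _ => c) t 0 :=
  ⟨1, one_pos, fun u _ _ => by simp⟩

theorem const_left (c : ℝ) (t : ℝ) : HasLeftSlope (fun _ => c) t 0 :=
  ⟨1, one_pos, fun u _ _ => by simp⟩

theorem phi_right (Δ : G.DivT) (a : ℤ) (e : G.E) (t : ℝ) :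
    HasRightSlope (G.phi Δ a e) t (a + ∑ p ∈ Δ.support, Δ p * G.rsl e p t) :=
  (lin_right a t).add (HasRightSlope.sum _ fun p _ => (G.rmp_right e p t).mul (Δ p))

theorem phi_left (Δ : G.DivT) (a : ℤ) (e : G.E) (t : ℝ) :
    HasLeftSlope (G.phi Δ a e) t (-a + ∑ p ∈ Δ.support, Δ p * G.lsl e p t) :=
  (lin_left a t).add (HasLeftSlope.sum _ fun p _ => (G.rmp_left e p t).mul (Δ p))

theorem rsl_zero (e : G.E) (p : G.Pt) : G.rsl e p 0 = 0 := by
  rcases p with v | q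
  · rfl
  · simp only [rsl]
    rw [if_neg]
    rintro ⟨-, h⟩
    exact absurd q.2.2.1 (not_lt.2 h)

theorem lsl_len (e : G.E) (p : G.Pt) : G.lsl e p (G.len e) = - G.onE e p := by
  rcases p with v | q
  · rfl
  · simp only [lsl, onE]
    by_cases h : q.1 = e
    · subst h
      simp [q.2.2.2]
    · simp [h]

theorem rsl_add_lsl (e : G.E) (p : G.Pt) (t : ℝ) (h : 0 < t ∧ t < G.len e) (x : G.Pt)
    (hx : x = Sum.inr ⟨e, ⟨t, h⟩⟩) :
    G.rsl e p t + G.lsl e p t = if p = x then 1 else 0 := by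
  by_cases hp : p = x
  · rw [if_pos hp, hp, hx]; simp [rsl, lsl]
  · rw [if_neg hp]
    rcases p with v | ⟨e', s, hs⟩
    · simp [rsl, lsl]
    · simp only [rsl, lsl]
      by_cases he : e' = e
      · subst he
        rcases lt_trichotomy s t with h1 | h1 | h1
        · simp [h1, h1.le]
        · subst h1; exact absurd hx.symm hp
        · simp [not_le.2 h1, not_lt.2 h1.le]
      · simp [he]

theorem sum_ind (Δ : G.DivT) (x : G.Pt) :
    ∑ p ∈ Δ.support, Δ p * (if p = x then 1 else 0) = Δ x := by
  simp only [mul_ite, mul_one, mul_zero]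
  rw [Finset.sum_ite_eq']
  split_ifs with h'
  · rfl
  · exact (Finsupp.notMem_support_iff.1 h').symm

theorem phi_right_zero (Δ : G.DivT) (a : ℤ) (e : G.E) : HasRightSlope (G.phi Δ a e) 0 a := by
  have := G.phi_right Δ a e 0
  simpa [rsl_zero] using this

theorem phi_left_len (Δ : G.DivT) (a : ℤ) (e : G.E) :
    HasLeftSlope (G.phi Δ a e) (G.len e) (-(a + G.sdeg Δ e)) := by
  have := G.phi_left Δ a e (G.len e)
  simp only [lsl_len] at this
  convert this using 1
  simp [sdeg]; ring

theorem phi_interior (Δ : G.DivT) (a : ℤ) (e : G.E) (t : ℝ) (h : 0 < t ∧ t < G.len e) :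
    ∃ s₁ s₂ : ℤ, HasRightSlope (G.phi Δ a e) t s₁ ∧ HasLeftSlope (G.phi Δ a e) t s₂ ∧
      Δ (Sum.inr ⟨e, ⟨t, h⟩⟩) = s₁ + s₂ := by
  refine ⟨_, _, G.phi_right Δ a e t, G.phi_left Δ a e t, ?_⟩
  refine (G.sum_ind Δ _).symm.trans ?_
  generalize hx : (Sum.inr ⟨e, ⟨t, h⟩⟩ : G.Pt) = x
  simp only [← G.rsl_add_lsl e _ t h x hx.symm, mul_add, Finset.sum_add_distrib]
  ring

theorem phi_zero (Δ : G.DivT) (a : ℤ) (e : G.E) : G.phi Δ a e 0 = 0 := by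
  simp only [phi, mul_zero, zero_add]
  apply Finset.sum_eq_zero
  intro p _
  rcases p with v | q
  · simp [rmp]
  · simp only [rmp]
    rw [max_eq_right (by linarith [q.2.2.1])]; simp

theorem phi_len (Δ : G.DivT) (a : ℤ) (e : G.E) :
    G.phi Δ a e (G.len e) = a * G.len e + G.rval Δ e := rfl

theorem onEdge_zero (f : G.Pt → ℝ) (e : G.E) : G.onEdge f e 0 = f (Sum.inl (G.src e)) := by
  simp [onEdge]

theorem onEdge_len (f : G.Pt → ℝ) (e : G.E) : G.onEdge f e (G.len e) = f (Sum.inl (G.tgt e)) := by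
  simp [onEdge, G.len_pos e]

theorem mem_dartsAt_s8 (v : G.V) (d : G.E × Bool) : d ∈ G.dartsAt v ↔ G.dartBase d = v := by
  rcases d with ⟨e, _ | _⟩ <;> simp [dartsAt, dartBase]

theorem exists_isDivisorOf_iff (Δ : G.DivT) :
    (∃ f, G.IsDivisorOf f Δ) ↔ ∃ (a : G.E → ℤ) (F : G.V → ℝ),
      (∀ e, F (G.tgt e) - F (G.src e) = a e * G.len e + G.rval Δ e) ∧
      ∀ v, Δ (Sum.inl v) =
        ∑ d ∈ G.dartsAt v, if d.2 then a d.1 else -(a d.1 + G.sdeg Δ d.1) := by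
  constructor
  · rintro ⟨f, -, hint, hv⟩
    choose s hs hsum using hv
    let a : G.E → ℤ := fun e => s (G.src e) (e, true)
    have ha : ∀ e, HasRightSlope (G.onEdge f e) 0 (a e) := by
      intro e
      have := hs (G.src e) (e, true) (by simp [mem_dartsAt_s8, dartBase])
      simpa using this
    have hb : ∀ e, HasLeftSlope (G.onEdge f e) (G.len e) (s (G.tgt e) (e, false)) := by
      intro e
      have := hs (G.tgt e) (e, false) (by simp [mem_dartsAt_s8, dartBase])
      simpa using this
    have key : ∀ e t, 0 ≤ t → t ≤ G.len e →
        G.onEdge f e t = f (Sum.inl (G.src e)) + G.phi Δ (a e) e t := by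
      intro e
      have := const_of_slopes (G.len e)
        (fun t => G.onEdge f e t + ((-1 : ℤ) : ℝ) * G.phi Δ (a e) e t) ?_ ?_ ?_
      · intro t h0 h1
        have := this t h0 h1
        simp only [onEdge_zero, phi_zero] at this
        push_cast at this
        linarith
      · have := (ha e).add ((G.phi_right_zero Δ (a e) e).mul (-1))
        simpa using this
      · intro t h0 h1
        obtain ⟨s1, s2, h1', h2', h3'⟩ := hint e t ⟨h0, h1⟩
        obtain ⟨r1, r2, h1'', h2'', h3''⟩ := G.phi_interior Δ (a e) e t ⟨h0, h1⟩
        exact ⟨_, _, h1'.add (h1''.mul (-1)), h2'.add (h2''.mul (-1)), by linarith⟩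
      · exact ⟨_, (hb e).add ((G.phi_left_len Δ (a e) e).mul (-1))⟩
    have hb' : ∀ e, s (G.tgt e) (e, false) = -(a e + G.sdeg Δ e) := by
      intro e
      refine (hb e).unique ?_
      have := (const_left (f (Sum.inl (G.src e))) (G.len e)).add (G.phi_left_len Δ (a e) e)
      rw [zero_add] at this
      exact this.congr 0 (G.len_pos e) fun t h0 h1 => key e t h0.le h1
    refine ⟨a, fun v => f (Sum.inl v), ?_, ?_⟩
    · intro e
      have := key e _ (G.len_pos e).le le_rfl
      rw [onEdge_len, phi_len] at this
      linarith
    · intro v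
      rw [hsum v]
      apply Finset.sum_congr rfl
      rintro ⟨e, b⟩ hd
      rw [mem_dartsAt_s8] at hd
      cases b
      · simp only [dartBase, Bool.false_eq_true, if_false] at hd
        subst hd
        simp [hb']
      · simp only [dartBase, if_true] at hd
        subst hd
        simp [a]
  · rintro ⟨a, F, hF, hv⟩
    let f : G.Pt → ℝ := fun p => match p with
      | Sum.inl v => F v
      | Sum.inr q => F (G.src q.1) + G.phi Δ (a q.1) q.1 q.2.1
    have key : ∀ e t, 0 ≤ t → t ≤ G.len e →
        G.onEdge f e t = F (G.src e) + G.phi Δ (a e) e t := by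
      intro e t h0 h1
      rcases eq_or_lt_of_le h0 with h | h
      · rw [← h, onEdge_zero, phi_zero]; simp [f]
      · rcases eq_or_lt_of_le h1 with h' | h'
        · rw [h', onEdge_len, phi_len]; simp only [f]; linarith [hF e]
        · simp [onEdge, h, h', f]
    have R : ∀ e t s, 0 ≤ t → t < G.len e → HasRightSlope (G.phi Δ (a e) e) t s →
        HasRightSlope (G.onEdge f e) t s := by
      intro e t s h0 h1 h
      have := (const_right (F (G.src e)) t).add h
      rw [zero_add] at this
      exact this.congr (G.len e) h1 fun u hu hu' => key e u (h0.trans hu) hu'.le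
    have Lf : ∀ e t s, 0 < t → t ≤ G.len e → HasLeftSlope (G.phi Δ (a e) e) t s →
        HasLeftSlope (G.onEdge f e) t s := by
      intro e t s h0 h1 h
      have := (const_left (F (G.src e)) t).add h
      rw [zero_add] at this
      exact this.congr 0 h0 fun u hu hu' => key e u hu.le (hu'.trans h1)
    refine ⟨f, ?_, ?_, ?_⟩
    · intro e
      exact intPL_of_slopes _ (G.len_pos e) _
        (fun t h0 h1 => ⟨_, R e t _ h0 h1 (G.phi_right _ _ _ _)⟩)
        (fun t h0 h1 => ⟨_, Lf e t _ h0 h1 (G.phi_left _ _ _ _)⟩)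
    · intro e t h
      obtain ⟨s1, s2, h1, h2, h3⟩ := G.phi_interior Δ (a e) e t h
      exact ⟨s1, s2, R e t _ h.1.le h.2 h1, Lf e t _ h.1 h.2.le h2, h3⟩
    · intro v
      refine ⟨fun d => if d.2 then a d.1 else -(a d.1 + G.sdeg Δ d.1), ?_, hv v⟩
      rintro ⟨e, b⟩ -
      cases b
      · simpa using Lf e _ _ (G.len_pos e) le_rfl (G.phi_left_len Δ (a e) e)
      · simpa using R e _ _ le_rfl (G.len_pos e) (G.phi_right_zero Δ (a e) e)

theorem sum_dartsAt (v : G.V) (α β : G.E → ℤ) :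
    (∑ d ∈ G.dartsAt v, if d.2 then α d.1 else β d.1) =
      (∑ e, if G.src e = v then α e else 0) + ∑ e, if G.tgt e = v then β e else 0 := by
  rw [dartsAt, Finset.sum_filter, Fintype.sum_prod_type, ← Finset.sum_add_distrib]
  apply Finset.sum_congr rfl
  intro e _
  simp

end MGraph

/-! ### Pairings of divisors with weight functions -/

section Pairing

variable {X : Type*} {R : Type*} [CommRing R]

/-- the pairing of a divisor with a weight function -/
noncomputable def pr (W : X → R) (D : X →₀ ℤ) : R := D.sum fun x n => (n : R) * W x

theorem pr_sub (W : X → R) (D D' : X →₀ ℤ) : pr W (D - D') = pr W D - pr W D' :=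
  Finsupp.sum_sub_index fun a b c => by push_cast; ring

theorem pr_single (W : X → R) (x : X) (n : ℤ) : pr W (Finsupp.single x n) = n * W x :=
  Finsupp.sum_single_index (by simp)

theorem pr_add (W : X → R) (D D' : X →₀ ℤ) : pr W (D + D') = pr W D + pr W D' :=
  Finsupp.sum_add_index' (fun a => by simp) fun a b c => by push_cast; ring

theorem pr_zero (W : X → R) (D : X →₀ ℤ) (h : ∀ x, D x = 0 ∨ W x = 0) : pr W D = 0 := by
  apply Finset.sum_eq_zero
  intro x _
  rcases h x with h | h <;> simp [h]

theorem pr_congr (W : X → R) (D D' : X →₀ ℤ) (h : ∀ x, D x = D' x ∨ W x = 0) :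
    pr W D = pr W D' := by
  rw [← sub_eq_zero, ← pr_sub]
  apply pr_zero
  intro x
  rcases h x with h | h
  · left; simp [h]
  · right; exact h

theorem pr_W_add (W W' : X → R) (D : X →₀ ℤ) :
    pr (fun x => W x + W' x) D = pr W D + pr W' D := by
  simp only [pr, Finsupp.sum, mul_add, Finset.sum_add_distrib]

theorem pr_W_mul (c : R) (W : X → R) (D : X →₀ ℤ) :
    pr (fun x => c * W x) D = c * pr W D := by
  simp only [pr, Finsupp.sum, Finset.mul_sum]
  exact Finset.sum_congr rfl fun x _ => by ring

theorem pr_W_sum {ι : Type*} (T : Finset ι) (W : ι → X → R) (D : X →₀ ℤ) :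
    pr (fun x => ∑ i ∈ T, W i x) D = ∑ i ∈ T, pr (W i) D := by
  simp only [pr, Finsupp.sum, Finset.mul_sum]
  exact Finset.sum_comm

theorem pr_ind (x : X) (D : X →₀ ℤ) : pr (fun p => if p = x then (1 : R) else 0) D = D x := by
  simp only [pr, Finsupp.sum, mul_ite, mul_one, mul_zero]
  rw [Finset.sum_ite_eq']
  split_ifs with h'
  · rfl
  · rw [Finsupp.notMem_support_iff.1 h']; simp

theorem pr_cast (W : X → ℤ) (D : X →₀ ℤ) : pr (fun x => (W x : R)) D = ((pr W D : ℤ) : R) := by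
  simp [pr, Finsupp.sum]

theorem pr_nonneg (W : X → ℤ) (D : X →₀ ℤ) (h : ∀ x, 0 ≤ D x * W x) : 0 ≤ pr W D :=
  Finset.sum_nonneg fun x _ => by simpa using h x

theorem eq_zero_of_pr (W : X → ℤ) (D : X →₀ ℤ) (h : ∀ x, 0 ≤ D x * W x) (h0 : pr W D = 0) (x : X)
    (hW : W x ≠ 0) : D x = 0 := by
  by_contra hx
  have := (Finset.sum_eq_zero_iff_of_nonneg (fun x _ => by simpa using h x)).1 h0 x
    (Finsupp.mem_support_iff.2 hx)
  simp [hx, hW] at this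

theorem exists_pos (P : X → Prop) (D : X →₀ ℤ) (h : ∀ x, P x → 0 ≤ D x)
    (h0 : 0 < pr (fun x => if P x then (1 : ℤ) else 0) D) :
    ∃ p, P p ∧ ∀ x, P x → 0 ≤ (D - Finsupp.single p 1 : X →₀ ℤ) x := by
  obtain ⟨p, -, hp⟩ := Finset.exists_lt_of_sum_lt (s := D.support) (f := fun _ => (0 : ℤ))
    (g := fun x => ((D x : ℤ) : ℤ) * (if P x then (1 : ℤ) else 0)) (by simpa [pr, Finsupp.sum] using h0)
  by_cases hP : P p
  · refine ⟨p, hP, fun x hx => ?_⟩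
    simp only [hP, if_true, mul_one] at hp
    rw [Finsupp.sub_apply, Finsupp.single_apply]
    split_ifs with hh
    · subst hh; omega
    · have := h x hx; omega
  · simp [hP] at hp

theorem exists_one (P : X → Prop) (D : X →₀ ℤ) (h : ∀ x, P x → 0 ≤ D x)
    (h0 : pr (fun x => if P x then (1 : ℤ) else 0) D = 1) :
    ∃ p, P p ∧ ∀ x, P x → D x = (Finsupp.single p 1 : X →₀ ℤ) x := by
  obtain ⟨p, hp, hx⟩ := exists_pos P D h (by omega)
  refine ⟨p, hp, fun x hPx => ?_⟩
  have : (D - Finsupp.single p 1 : X →₀ ℤ) x = 0 := by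
    apply eq_zero_of_pr (fun x => if P x then (1 : ℤ) else 0)
    · intro y
      by_cases hy : P y
      · simp only [hy, if_true, mul_one]; exact hx y hy
      · simp [hy]
    · rw [pr_sub, pr_single, h0]; simp [hp]
    · simp [hPx]
  rw [Finsupp.sub_apply] at this
  omega

theorem exists_two (P : X → Prop) (D : X →₀ ℤ) (h : ∀ x, P x → 0 ≤ D x)
    (h0 : pr (fun x => if P x then (1 : ℤ) else 0) D = 2) :
    ∃ p q, P p ∧ P q ∧
      ∀ x, P x → D x = (Finsupp.single p 1 + Finsupp.single q 1 : X →₀ ℤ) x := by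
  obtain ⟨p, hp, hx⟩ := exists_pos P D h (by omega)
  obtain ⟨q, hq, hx'⟩ := exists_one P (D - Finsupp.single p 1) hx (by
    rw [pr_sub, pr_single, h0]; simp [hp])
  refine ⟨p, q, hp, hq, fun x hPx => ?_⟩
  have := hx' x hPx
  rw [Finsupp.sub_apply] at this
  rw [Finsupp.add_apply]
  omega

end Pairing

theorem MGraph.sdeg_eq (G : MGraph) (D : G.DivT) (e : G.E) : G.sdeg D e = pr (G.onE e) D := by
  simp [MGraph.sdeg, pr, Finsupp.sum]

theorem MGraph.rval_eq (G : MGraph) (D : G.DivT) (e : G.E) :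
    G.rval D e = pr (fun p => G.rmp e p (G.len e)) D := rfl

theorem MGraph.rmp_len (G : MGraph) (e : G.E) (q : (Σ e : G.E, {t : ℝ // 0 < t ∧ t < G.len e})) :
    G.rmp e (Sum.inr q) (G.len e) = if q.1 = e then G.len e - q.2.1 else 0 := by
  simp only [MGraph.rmp]
  split_ifs with h
  · subst h; exact max_eq_left (by linarith [q.2.2.2])
  · rfl

theorem MGraph.rmp_eq_zero (G : MGraph) (e : G.E) (p : G.Pt) (t : ℝ) (h : G.onE e p = 0) :
    G.rmp e p t = 0 := by
  rcases p with v | q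
  · rfl
  · simp only [MGraph.onE] at h
    by_cases hq : q.1 = e
    · simp [hq] at h
    · simp [MGraph.rmp, hq]

/-! ### The chain of loops -/

namespace BaseChainData

variable {g : ℕ} (B : BaseChainData g)

def eu (i : Fin (g - 1)) : B.graph.E := Sum.inl (Sum.inl i)
def el (i : Fin (g - 1)) : B.graph.E := Sum.inl (Sum.inr i)
def eb (j : Fin g) : B.graph.E := Sum.inr (Sum.inl j)
def ec : B.graph.E := Sum.inr (Sum.inr ())
def vv (j : Fin g) : B.graph.V := Sum.inl (Sum.inl j)
def ww (i : Fin (g - 1)) : B.graph.V := Sum.inl (Sum.inr i)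
def w00 : B.graph.V := Sum.inr ()
/-- inclusion of the indices of the proper loops -/
def ix (i : Fin (g - 1)) : Fin g := ⟨i.val, by have := i.isLt; omega⟩
def ix' (i : Fin (g - 1)) : Fin g := ⟨i.val + 1, by have := i.isLt; omega⟩
def i0 : Fin g := ⟨0, by have := B.hg; omega⟩
def il : Fin g := ⟨g - 1, by have := B.hg; omega⟩

theorem forallE {P : B.graph.E → Prop} (h1 : ∀ i, P (B.eu i)) (h2 : ∀ i, P (B.el i))
    (h3 : ∀ i, P (B.eb i)) (h4 : P B.ec) : ∀ e, P e := by
  rintro ((i | i) | (i | i))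
  · exact h1 i
  · exact h2 i
  · exact h3 i
  · exact h4

theorem forallV {P : B.graph.V → Prop} (h1 : ∀ i, P (B.vv i)) (h2 : ∀ i, P (B.ww i))
    (h3 : P B.w00) : ∀ e, P e := by
  rintro ((i | i) | i)
  · exact h1 i
  · exact h2 i
  · exact h3

theorem ix_cases (B : BaseChainData g) (j : Fin g) : j = B.il ∨ ∃ i, j = ix i := by
  by_cases h : j.val = g - 1
  · left; exact Fin.ext h
  · right; exact ⟨⟨j.val, by have := j.isLt; omega⟩, rfl⟩

theorem ix'_cases (B : BaseChainData g) (j : Fin g) : j = B.i0 ∨ ∃ i, j = ix' i := by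
  by_cases h : j.val = 0
  · left; exact Fin.ext h
  · right
    refine ⟨⟨j.val - 1, by have := j.isLt; omega⟩, Fin.ext ?_⟩
    simp only [ix']; omega

theorem sumE (h : B.graph.E → ℤ) : ∑ e, h e =
    (∑ i, h (B.eu i) + ∑ i, h (B.el i)) + (∑ j, h (B.eb j) + h B.ec) := by
  refine (Fintype.sum_sum_type (α₁ := Fin (g - 1) ⊕ Fin (g - 1)) (α₂ := Fin g ⊕ Unit) h).trans ?_
  rw [Fintype.sum_sum_type, Fintype.sum_sum_type]
  simp [eu, el, eb, ec]

theorem src_eu (i) : B.graph.src (B.eu i) = B.vv (ix i) := rfl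
theorem src_el (i) : B.graph.src (B.el i) = B.vv (ix i) := rfl
theorem src_ec : B.graph.src B.ec = B.vv B.il := rfl
theorem src_eb0 : B.graph.src (B.eb B.i0) = B.w00 := rfl
theorem src_eb' (i) : B.graph.src (B.eb (ix' i)) = B.ww i := rfl
theorem tgt_eu (i) : B.graph.tgt (B.eu i) = B.ww i := rfl
theorem tgt_el (i) : B.graph.tgt (B.el i) = B.ww i := rfl
theorem tgt_ec : B.graph.tgt B.ec = B.vv B.il := rfl
theorem tgt_eb (j) : B.graph.tgt (B.eb j) = B.vv j := rfl
theorem len_eu (i) : B.graph.len (B.eu i) = B.up i.val := rfl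
theorem len_el (i) : B.graph.len (B.el i) = 1 := rfl
theorem len_ec : B.graph.len B.ec = B.c := rfl

theorem vv_inj (i j) : B.vv i = B.vv j ↔ i = j :=
  ⟨fun h => Sum.inl_injective (Sum.inl_injective h), fun h => by rw [h]⟩
theorem ww_inj (i j) : B.ww i = B.ww j ↔ i = j :=
  ⟨fun h => Sum.inr_injective (Sum.inl_injective h), fun h => by rw [h]⟩
theorem vv_ne_ww (i j) : B.vv i = B.ww j ↔ False := by
  refine ⟨fun h => ?_, False.elim⟩
  cases h
theorem ww_ne_vv (i j) : B.ww i = B.vv j ↔ False := by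
  refine ⟨fun h => ?_, False.elim⟩
  cases h
theorem vv_ne_w (i) : B.vv i = B.w00 ↔ False := by
  refine ⟨fun h => ?_, False.elim⟩
  cases h
theorem ww_ne_w (i) : B.ww i = B.w00 ↔ False := by
  refine ⟨fun h => ?_, False.elim⟩
  cases h
theorem w_ne_vv (i) : B.w00 = B.vv i ↔ False := by
  refine ⟨fun h => ?_, False.elim⟩
  cases h
theorem w_ne_ww (i) : B.w00 = B.ww i ↔ False := by
  refine ⟨fun h => ?_, False.elim⟩
  cases h

theorem src_eb_w (j) : B.graph.src (B.eb j) = B.w00 ↔ j = B.i0 := by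
  rcases B.ix'_cases j with rfl | ⟨i, rfl⟩
  · simp [src_eb0]
  · rw [src_eb', ww_ne_w]; simp [ix', i0]

theorem src_eb_ww (j i) : B.graph.src (B.eb j) = B.ww i ↔ j = ix' i := by
  rcases B.ix'_cases j with rfl | ⟨i', rfl⟩
  · rw [src_eb0, w_ne_ww]; simp [ix', i0]
  · rw [src_eb', ww_inj]; simp [ix', Fin.ext_iff]

theorem src_eb_vv (j i) : B.graph.src (B.eb j) = B.vv i ↔ False := by
  rcases B.ix'_cases j with rfl | ⟨i', rfl⟩
  · simp [src_eb0, w_ne_vv]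
  · simp [src_eb', ww_ne_vv]

theorem ix_inj (i j : Fin (g - 1)) : ix i = ix j ↔ i = j := by simp [ix, Fin.ext_iff]

theorem ix_ne (i : Fin (g - 1)) : ix i = B.il ↔ False := by
  have := i.isLt
  simp [ix, il, Fin.ext_iff]; omega

theorem ix_ne' (i : Fin (g - 1)) : B.il = ix i ↔ False := by
  rw [eq_comm]; exact B.ix_ne i

variable (α β : B.graph.E → ℤ)

theorem darts_w : (∑ d ∈ B.graph.dartsAt B.w00, if d.2 then α d.1 else β d.1) = α (B.eb B.i0) := by
  rw [MGraph.sum_dartsAt, sumE, sumE]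
  simp [src_eu, src_el, src_ec, tgt_eu, tgt_el, tgt_ec, tgt_eb, src_eb_w, vv_ne_w, ww_ne_w]

theorem darts_vv (i) : (∑ d ∈ B.graph.dartsAt (B.vv (ix i)), if d.2 then α d.1 else β d.1) =
    α (B.eu i) + α (B.el i) + β (B.eb (ix i)) := by
  rw [MGraph.sum_dartsAt, sumE, sumE]
  simp [src_eu, src_el, src_ec, tgt_eu, tgt_el, tgt_ec, tgt_eb, src_eb_vv, vv_inj, ww_ne_vv,
    ix_inj, ix_ne, ix_ne']

theorem darts_ww (i) : (∑ d ∈ B.graph.dartsAt (B.ww i), if d.2 then α d.1 else β d.1) =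
    α (B.eb (ix' i)) + β (B.eu i) + β (B.el i) := by
  rw [MGraph.sum_dartsAt, sumE, sumE]
  simp [src_eu, src_el, src_ec, tgt_eu, tgt_el, tgt_ec, tgt_eb, src_eb_ww, vv_ne_ww, ww_inj]
  ring

theorem darts_vl : (∑ d ∈ B.graph.dartsAt (B.vv B.il), if d.2 then α d.1 else β d.1) =
    α B.ec + β B.ec + β (B.eb B.il) := by
  rw [MGraph.sum_dartsAt, sumE, sumE]
  simp [src_eu, src_el, src_ec, tgt_eu, tgt_el, tgt_ec, tgt_eb, src_eb_vv, vv_inj, ww_ne_vv,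
    ix_ne, ix_ne']
  ring

end BaseChainData

namespace BaseChainData

variable {g : ℕ} (B : BaseChainData g)

def pV (v : B.graph.V) : B.graph.Pt := Sum.inl v
def pI (e : B.graph.E) (t : {t : ℝ // 0 < t ∧ t < B.graph.len e}) : B.graph.Pt := Sum.inr ⟨e, t⟩

theorem pV_inj (v v') : B.pV v = B.pV v' ↔ v = v' :=
  ⟨fun h => Sum.inl_injective h, fun h => by rw [h]⟩

theorem pI_ne (e t v) : B.pI e t = B.pV v ↔ False := by
  refine ⟨fun h => ?_, False.elim⟩
  cases h

theorem pV_ne (e t v) : B.pV v = B.pI e t ↔ False := by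
  refine ⟨fun h => ?_, False.elim⟩
  cases h

theorem forallPt {P : B.graph.Pt → Prop} (h1 : ∀ v, P (B.pV v)) (h2 : ∀ e t, P (B.pI e t)) :
    ∀ p, P p := by
  rintro (v | ⟨e, t⟩)
  · exact h1 v
  · exact h2 e t

theorem eNe : (∀ i j, B.eu i = B.el j ↔ False) ∧ (∀ i j, B.el i = B.eu j ↔ False) ∧
    (∀ i j, B.eu i = B.eb j ↔ False) ∧ (∀ i j, B.el i = B.eb j ↔ False) ∧
    (∀ i j, B.eb i = B.eu j ↔ False) ∧ (∀ i j, B.eb i = B.el j ↔ False) ∧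
    (∀ i, B.eu i = B.ec ↔ False) ∧ (∀ i, B.el i = B.ec ↔ False) ∧ (∀ i, B.eb i = B.ec ↔ False) ∧
    (∀ i, B.ec = B.eu i ↔ False) ∧ (∀ i, B.ec = B.el i ↔ False) ∧ (∀ i, B.ec = B.eb i ↔ False) := by
  refine ⟨?_, ?_, ?_, ?_, ?_, ?_, ?_, ?_, ?_, ?_, ?_, ?_⟩ <;> intros <;>
    exact ⟨fun h => (by cases h), False.elim⟩

theorem eu_inj (i j) : B.eu i = B.eu j ↔ i = j :=
  ⟨fun h => Sum.inl_injective (Sum.inl_injective h), fun h => by rw [h]⟩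
theorem el_inj (i j) : B.el i = B.el j ↔ i = j :=
  ⟨fun h => Sum.inr_injective (Sum.inl_injective h), fun h => by rw [h]⟩
theorem eb_inj (i j) : B.eb i = B.eb j ↔ i = j :=
  ⟨fun h => Sum.inl_injective (Sum.inr_injective h), fun h => by rw [h]⟩

theorem onE_V (e v) : B.graph.onE e (B.pV v) = 0 := rfl
theorem onE_I (e e' t) : B.graph.onE e (B.pI e' t) = if e' = e then 1 else 0 := rfl
theorem rmp_V (e v s) : B.graph.rmp e (B.pV v) s = 0 := rfl
theorem rmp_I (e e' t) :
    B.graph.rmp e (B.pI e' t) (B.graph.len e) = if e' = e then B.graph.len e - t.1 else 0 :=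
  B.graph.rmp_len e ⟨e', t⟩

theorem onLoop_vv (i j) : B.onLoop i (B.pV (B.vv j)) ↔ j = ix i := by
  rw [Fin.ext_iff]; exact Iff.rfl
theorem onLoop_ww (i j) : B.onLoop i (B.pV (B.ww j)) ↔ j = i := by
  rw [Fin.ext_iff]; exact Iff.rfl
theorem onLoop_w (i) : B.onLoop i (B.pV B.w00) ↔ False := Iff.rfl
theorem onLoop_eu (i j t) : B.onLoop i (B.pI (B.eu j) t) ↔ j = i := by
  rw [Fin.ext_iff]; exact Iff.rfl
theorem onLoop_el (i j t) : B.onLoop i (B.pI (B.el j) t) ↔ j = i := by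
  rw [Fin.ext_iff]; exact Iff.rfl
theorem onLoop_eb (i j t) : B.onLoop i (B.pI (B.eb j) t) ↔ False := Iff.rfl
theorem onLoop_ec (i t) : B.onLoop i (B.pI B.ec t) ↔ False := Iff.rfl

theorem onLast_vv (j) : B.onLastLoop (B.pV (B.vv j)) ↔ j = B.il := by
  rw [Fin.ext_iff]; exact Iff.rfl
theorem onLast_ww (j) : B.onLastLoop (B.pV (B.ww j)) ↔ False := Iff.rfl
theorem onLast_w : B.onLastLoop (B.pV B.w00) ↔ False := Iff.rfl
theorem onLast_eu (j t) : B.onLastLoop (B.pI (B.eu j) t) ↔ False := Iff.rfl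
theorem onLast_el (j t) : B.onLastLoop (B.pI (B.el j) t) ↔ False := Iff.rfl
theorem onLast_eb (j t) : B.onLastLoop (B.pI (B.eb j) t) ↔ False := Iff.rfl
theorem onLast_ec (t) : B.onLastLoop (B.pI B.ec t) ↔ True := Iff.rfl

theorem loopPos_vv (i j) : B.loopPos i (B.pV (B.vv j)) = 0 := rfl
theorem loopPos_ww (i j) : B.loopPos i (B.pV (B.ww j)) = B.up i.val := rfl
theorem loopPos_eu (i j t) : B.loopPos i (B.pI (B.eu j) t) = t.1 := rfl
theorem loopPos_el (i j t) : B.loopPos i (B.pI (B.el j) t) = B.up i.val + 1 - t.1 := rfl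

theorem loop_ind (i) (p : B.graph.Pt) : (if B.onLoop i p then (1 : ℤ) else 0) =
    (if p = B.pV (B.vv (ix i)) then 1 else 0) + (if p = B.pV (B.ww i) then 1 else 0) +
      B.graph.onE (B.eu i) p + B.graph.onE (B.el i) p := by
  revert p
  refine B.forallPt (B.forallV ?_ ?_ ?_) (B.forallE ?_ ?_ ?_ ?_) <;> intros <;>
    simp [onLoop_vv, onLoop_ww, onLoop_w, onLoop_eu, onLoop_el, onLoop_eb, onLoop_ec, pV_inj, vv_inj,
      ww_inj, vv_ne_ww, ww_ne_vv, w_ne_vv, w_ne_ww, pI_ne, onE_V, onE_I, eNe, eu_inj, el_inj]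

theorem last_ind (p : B.graph.Pt) : (if B.onLastLoop p then (1 : ℤ) else 0) =
    (if p = B.pV (B.vv B.il) then 1 else 0) + B.graph.onE B.ec p := by
  revert p
  refine B.forallPt (B.forallV ?_ ?_ ?_) (B.forallE ?_ ?_ ?_ ?_) <;> intros <;>
    simp [onLast_vv, onLast_ww, onLast_w, onLast_eu, onLast_el, onLast_eb, onLast_ec, pV_inj, vv_inj,
      ww_ne_vv, w_ne_vv, pI_ne, onE_V, onE_I, eNe]

theorem all_ind (p : B.graph.Pt) : (1 : ℤ) =
    (∑ i, if B.onLoop i p then (1 : ℤ) else 0) + (if B.onLastLoop p then (1 : ℤ) else 0) +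
      (if p = B.pV B.w00 then 1 else 0) + ∑ j, B.graph.onE (B.eb j) p := by
  revert p
  refine B.forallPt (B.forallV ?_ ?_ ?_) (B.forallE ?_ ?_ ?_ ?_)
  · intro j
    rcases B.ix_cases j with rfl | ⟨i, rfl⟩
    · simp [onLoop_vv, onLast_vv, pV_inj, vv_ne_w, onE_V, ix_ne']
    · simp [onLoop_vv, onLast_vv, pV_inj, vv_ne_w, onE_V, ix_ne, ix_inj]
  all_goals
    intros
    simp [onLast_ww, onLast_w, onLast_eu, onLast_el, onLast_eb, onLast_ec,
      onLoop_ww, onLoop_w, onLoop_eu, onLoop_el, onLoop_eb, onLoop_ec, pV_inj,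
      ww_ne_w, pI_ne, onE_V, onE_I, eNe, eb_inj]

theorem pos_ind (i) (p : B.graph.Pt) : (if B.onLoop i p then B.loopPos i p else 0) =
    B.up i.val * (if p = B.pV (B.ww i) then 1 else 0) +
      B.up i.val * (B.graph.onE (B.eu i) p : ℝ) +
      (-1) * B.graph.rmp (B.eu i) p (B.graph.len (B.eu i)) +
      B.up i.val * (B.graph.onE (B.el i) p : ℝ) +
      B.graph.rmp (B.el i) p (B.graph.len (B.el i)) := by
  revert p
  refine B.forallPt (B.forallV ?_ ?_ ?_) (B.forallE ?_ ?_ ?_ ?_)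
  case refine_4 =>
    intro j t
    by_cases h : j = i
    · subst h
      simp [onLoop_eu, loopPos_eu, pI_ne, onE_I, rmp_I, eNe]; simp [len_eu]
    · simp [onLoop_eu, pI_ne, onE_I, rmp_I, eNe, eu_inj, h]
  case refine_5 =>
    intro j t
    by_cases h : j = i
    · subst h
      simp [onLoop_el, loopPos_el, pI_ne, onE_I, rmp_I, eNe]; simp only [len_el]; ring
    · simp [onLoop_el, pI_ne, onE_I, rmp_I, eNe, el_inj, h]
  all_goals
    intros
    simp [onLoop_vv, onLoop_ww, onLoop_w, onLoop_eb, onLoop_ec, pV_inj, loopPos_vv, loopPos_ww,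
      ww_inj, vv_ne_ww, w_ne_ww, pI_ne, onE_V, onE_I, eNe, rmp_V, rmp_I]

theorem degOn_eq (D : B.graph.DivT) (P : B.graph.Pt → Prop) :
    B.degOn D P = pr (fun x => if P x then (1 : ℤ) else 0) D := by
  simp [degOn, pr]

theorem degD_eq (D : B.graph.DivT) : B.graph.degD D = pr (fun _ => (1 : ℤ)) D := by
  simp [MGraph.degD, pr]

theorem KDiv_eq : B.KDiv = Finsupp.single (B.pV B.w00) (-1)
    + (∑ i : Fin (g - 1), (Finsupp.single (B.pV (B.vv (ix i))) 1
          + Finsupp.single (B.pV (B.ww i)) 1)) + Finsupp.single (B.pV (B.vv B.il)) 1 := rfl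

theorem K_I (e t) : B.KDiv (B.pI e t) = 0 := by
  simp [KDiv_eq, Finsupp.single_apply, pV_ne]

theorem K_w : B.KDiv (B.pV B.w00) = -1 := by
  simp [KDiv_eq, Finsupp.single_apply, pV_inj, vv_ne_w, ww_ne_w]

theorem K_vv (i) : B.KDiv (B.pV (B.vv i)) = 1 := by
  rcases B.ix_cases i with rfl | ⟨i, rfl⟩ <;>
  simp [KDiv_eq, Finsupp.single_apply, pV_inj, vv_inj, ww_ne_vv, w_ne_vv, ix_ne, ix_ne', ix_inj]

theorem K_ww (i) : B.KDiv (B.pV (B.ww i)) = 1 := by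
  simp [KDiv_eq, Finsupp.single_apply, pV_inj, vv_ne_ww, ww_inj, w_ne_ww]

theorem sdeg_sub_K (D : B.graph.DivT) (e) : B.graph.sdeg (D - B.KDiv) e = B.graph.sdeg D e := by
  rw [MGraph.sdeg_eq, MGraph.sdeg_eq]
  apply pr_congr
  refine B.forallPt ?_ ?_
  · intro v; right; rfl
  · intro e t; left; rw [Finsupp.sub_apply, K_I]; simp

theorem rval_sub_K (D : B.graph.DivT) (e) : B.graph.rval (D - B.KDiv) e = B.graph.rval D e := by
  rw [MGraph.rval_eq, MGraph.rval_eq]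
  apply pr_congr
  refine B.forallPt ?_ ?_
  · intro v; right; rfl
  · intro e t; left; rw [Finsupp.sub_apply, K_I]; simp

end BaseChainData

theorem no_int (a : ℤ) (L t : ℝ) (t0 : 0 < t) (t1 : t < L) (h : 0 = a * L + (L - t)) : False := by
  have h2 : ((a + 1 : ℤ) : ℝ) * L = t := by push_cast; linarith
  have h3 : 0 < a + 1 := by
    by_contra h
    have : ((a + 1 : ℤ) : ℝ) ≤ 0 := by exact_mod_cast (not_lt.1 h)
    nlinarith
  have h4 : (1 : ℝ) ≤ ((a + 1 : ℤ) : ℝ) := by exact_mod_cast h3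
  nlinarith

theorem equivalent_to_canonical_iff_symmetric
    (g : ℕ) (B : BaseChainData g) (D : B.graph.DivT)
    (hdeg : B.graph.degD D = 2 * (g : ℤ) - 2)
    (heff : B.graph.EffectiveD (D + Finsupp.single B.w0Pt 1))
    (hloops : ∀ i : Fin (g - 1), B.degOn D (B.onLoop i) = 2)
    (hlast : B.degOn D B.onLastLoop = 1) :
    B.graph.LinEq D B.KDiv ↔
      ((∀ i : Fin (g - 1), ∃ p q : B.graph.Pt, B.onLoop i p ∧ B.onLoop i q ∧
        (∀ x, B.onLoop i x → D x = ((Finsupp.single p 1 + Finsupp.single q 1 : B.graph.DivT)) x) ∧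
        -- the counterclockwise distance of `p` from `v_i` equals the clockwise
        -- distance of `q` from `w_i`
        ∃ k : ℤ, B.loopPos i p + B.loopPos i q = B.up i.val + (k : ℝ) * (B.up i.val + 1)) ∧
      -- and the restriction of `D` to the last loop is its vertex
      (∀ x, B.onLastLoop x → D x = (Finsupp.single B.vLastPt 1) x)) := by
  have hw : -1 ≤ D (B.pV B.w00) := by
    have := heff (B.pV B.w00)
    rw [Finsupp.add_apply] at this
    have h1 : (Finsupp.single B.w0Pt 1 : B.graph.DivT) (B.pV B.w00) = 1 := Finsupp.single_eq_same
    omega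
  have hpos : ∀ x, x ≠ B.pV B.w00 → 0 ≤ D x := by
    intro x hx
    have := heff x
    rw [Finsupp.add_apply] at this
    have h1 : (Finsupp.single B.w0Pt 1 : B.graph.DivT) x = 0 := Finsupp.single_eq_of_ne hx
    omega
  have hposL : ∀ i x, B.onLoop i x → 0 ≤ D x := by
    intro i x hx
    apply hpos
    rintro rfl
    exact (B.onLoop_w i).1 hx
  have hposC : ∀ x, B.onLastLoop x → 0 ≤ D x := by
    intro x hx
    apply hpos
    rintro rfl
    exact B.onLast_w.1 hx
  simp only [B.degOn_eq] at hloops hlast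
  -- degrees on the loops
  have hL : ∀ i, D (B.pV (B.vv (BaseChainData.ix i))) + D (B.pV (B.ww i)) + B.graph.sdeg D (B.eu i)
      + B.graph.sdeg D (B.el i) = 2 := by
    intro i
    rw [← hloops i, funext (B.loop_ind i)]
    simp only [pr_W_add, pr_ind, MGraph.sdeg_eq, Int.cast_id]
  have hC : D (B.pV (B.vv B.il)) + B.graph.sdeg D B.ec = 1 := by
    rw [← hlast, funext B.last_ind]
    simp only [pr_W_add, pr_ind, MGraph.sdeg_eq, Int.cast_id]
  -- nothing on the bridges
  have hnn : ∀ j x, 0 ≤ D x * B.graph.onE (B.eb j) x := by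
    intro j
    refine B.forallPt ?_ ?_
    · intro v; simp [B.onE_V]
    · intro e t
      have := hpos (B.pI e t) (fun h => (B.pI_ne _ _ _).1 h)
      rw [B.onE_I]; split_ifs <;> simp [this]
  have hall : D (B.pV B.w00) + ∑ j, pr (B.graph.onE (B.eb j)) D = -1 := by
    have h1 := hdeg
    rw [B.degD_eq, funext B.all_ind] at h1
    simp only [pr_W_add, pr_W_sum, pr_ind, Int.cast_id, hloops, hlast] at h1
    have hg := B.hg
    simp at h1
    have : ((g - 1 : ℕ) : ℤ) = g - 1 := by omega
    rw [this] at h1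
    linarith
  have hbr0 : ∀ j, pr (B.graph.onE (B.eb j)) D = 0 := by
    have h1 : 0 ≤ ∑ j, pr (B.graph.onE (B.eb j)) D :=
      Finset.sum_nonneg fun j _ => pr_nonneg _ _ (hnn j)
    have h2 : ∑ j, pr (B.graph.onE (B.eb j)) D = 0 := by omega
    intro j
    exact (Finset.sum_eq_zero_iff_of_nonneg (fun j _ => pr_nonneg _ _ (hnn j))).1 h2 j
      (Finset.mem_univ j)
  have hw1 : D (B.pV B.w00) = -1 := by
    simp only [hbr0, Finset.sum_const_zero] at hall; omega
  have hbS : ∀ j, B.graph.sdeg D (B.eb j) = 0 := fun j => by rw [MGraph.sdeg_eq, hbr0]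
  have hbR : ∀ j, B.graph.rval D (B.eb j) = 0 := by
    intro j
    rw [MGraph.rval_eq]
    apply pr_zero
    intro x
    by_cases h : B.graph.onE (B.eb j) x = 0
    · right; exact MGraph.rmp_eq_zero _ _ _ _ h
    · left; exact eq_zero_of_pr _ D (hnn j) (hbr0 j) x h
  -- positions on the loops
  have hP : ∀ i, pr (fun p => if B.onLoop i p then B.loopPos i p else 0) D =
      B.up i.val * D (B.pV (B.ww i)) + B.up i.val * B.graph.sdeg D (B.eu i)
      + (-1) * B.graph.rval D (B.eu i) + B.up i.val * B.graph.sdeg D (B.el i)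
      + B.graph.rval D (B.el i) := by
    intro i
    rw [funext (B.pos_ind i)]
    simp only [pr_W_add, pr_W_mul, pr_ind, MGraph.sdeg_eq, MGraph.rval_eq, pr_cast]
  have hPpq : ∀ i p q, B.onLoop i p → B.onLoop i q →
      (∀ x, B.onLoop i x → D x = ((Finsupp.single p 1 + Finsupp.single q 1 : B.graph.DivT)) x) →
      pr (fun p => if B.onLoop i p then B.loopPos i p else 0) D = B.loopPos i p + B.loopPos i q := by
    intro i p q hp hq h
    rw [pr_congr _ D (Finsupp.single p 1 + Finsupp.single q 1), pr_add, pr_single, pr_single]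
    · simp [hp, hq]
    · intro x
      by_cases hx : B.onLoop i x
      · left; exact h x hx
      · right; simp [hx]
  have hLR : ∀ i, (D (B.pV (B.vv (BaseChainData.ix i))) : ℝ) + D (B.pV (B.ww i)) + B.graph.sdeg D (B.eu i)
      + B.graph.sdeg D (B.el i) = 2 := fun i => by exact_mod_cast hL i
  have hcR : ∀ p, (∀ x, B.onLastLoop x → D x = (Finsupp.single p 1 : B.graph.DivT) x) →
      B.graph.rval D B.ec = B.graph.rmp B.ec p (B.graph.len B.ec) := by
    intro p h
    rw [MGraph.rval_eq, pr_congr _ D (Finsupp.single p 1), pr_single]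
    · simp
    · intro x
      by_cases hx : B.onLastLoop x
      · left; exact h x hx
      · right
        apply MGraph.rmp_eq_zero
        have := B.last_ind x
        rw [if_neg hx] at this
        have h0 : 0 ≤ B.graph.onE B.ec x := by
          revert x
          refine B.forallPt ?_ ?_
          · intros; simp [B.onE_V]
          · intros; rw [B.onE_I]; split_ifs <;> simp
        split_ifs at this <;> omega
  rw [MGraph.LinEq, MGraph.exists_isDivisorOf_iff]
  simp only [B.sdeg_sub_K, B.rval_sub_K]
  constructor
  · rintro ⟨a, F, hF, hv⟩
    have hv' : ∀ v, D (B.pV v) - B.KDiv (B.pV v) = _ := hv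
    -- slopes on the bridges vanish
    have e0 : a (B.eb B.i0) = 0 := by
      have := hv' B.w00
      rw [B.darts_w a (fun e => -(a e + B.graph.sdeg D e)), hw1, B.K_w] at this
      omega
    have e1 : ∀ i, D (B.pV (B.vv (BaseChainData.ix i))) - 1 = a (B.eu i) + a (B.el i) - a (B.eb (BaseChainData.ix i)) := by
      intro i
      have := hv' (B.vv (BaseChainData.ix i))
      rw [B.darts_vv a (fun e => -(a e + B.graph.sdeg D e)), B.K_vv, hbS] at this
      omega
    have e2 : ∀ i, a (B.eb (BaseChainData.ix' i)) = a (B.eb (BaseChainData.ix i)) := by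
      intro i
      have h1 := hv' (B.ww i)
      rw [B.darts_ww a (fun e => -(a e + B.graph.sdeg D e)), B.K_ww] at h1
      have h2 := e1 i
      have h3 := hL i
      omega
    have e3 : ∀ n (hn : n < g), a (B.eb ⟨n, hn⟩) = 0 := by
      intro n
      induction n with
      | zero => intro _; exact e0
      | succ n ih =>
        intro hn
        exact (e2 ⟨n, by omega⟩).trans (ih (by omega))
    refine ⟨?_, ?_⟩
    · intro i
      obtain ⟨p, q, hp, hq, hpq⟩ := exists_two (B.onLoop i) D (hposL i) (hloops i)
      refine ⟨p, q, hp, hq, hpq, - a (B.el i), ?_⟩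
      rw [← hPpq i p q hp hq hpq, hP i]
      have h1 := hF (B.eu i)
      have h2 := hF (B.el i)
      rw [B.src_eu, B.tgt_eu, B.len_eu] at h1
      rw [B.src_el, B.tgt_el, B.len_el] at h2
      have h3 := e1 i
      rw [show a (B.eb (BaseChainData.ix i)) = 0 from e3 _ _] at h3
      have h3' : (D (B.pV (B.vv (BaseChainData.ix i))) : ℝ) - 1 = a (B.eu i) + a (B.el i) - (0 : ℤ) := by
        exact_mod_cast h3
      have h4 := hLR i
      push_cast at h3' ⊢
      linear_combination h1 - h2 + B.up i.val * h4 - B.up i.val * h3'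
    · obtain ⟨p, hp, hpx⟩ := exists_one B.onLastLoop D hposC hlast
      have hR := hcR p hpx
      have h1 := hF B.ec
      rw [B.src_ec, B.tgt_ec, hR] at h1
      have hpv : p = B.pV (B.vv B.il) := by
        by_contra hne
        have := B.last_ind p
        rw [if_pos hp, if_neg hne] at this
        revert p
        refine B.forallPt ?_ ?_
        · intro v _ _ _ _ _ h; simp [B.onE_V] at h
        · intro e t _ _ _ h1 _ h
          rw [B.onE_I] at h
          have he : e = B.ec := by
            by_contra he; simp [he] at h
          subst he
          rw [B.rmp_I, if_pos rfl] at h1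
          rw [sub_self] at h1
          exact no_int _ _ _ t.2.1 t.2.2 h1
      subst hpv
      exact hpx
  · rintro ⟨hloop, hlst⟩
    choose p q hp hq hpq k hk using hloop
    have hRc : B.graph.rval D B.ec = 0 := by
      rw [hcR _ hlst]; rfl
    let α : Fin (g - 1) → ℤ := fun i => D (B.pV (B.vv (BaseChainData.ix i))) - 1 + k i
    let a : B.graph.E → ℤ := fun e => match e with
      | Sum.inl (Sum.inl i) => α i
      | Sum.inl (Sum.inr i) => - k i
      | Sum.inr _ => 0
    have a_eu : ∀ i, a (B.eu i) = α i := fun _ => rfl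
    have a_el : ∀ i, a (B.el i) = - k i := fun _ => rfl
    have a_eb : ∀ i, a (B.eb i) = 0 := fun _ => rfl
    have a_ec : a B.ec = 0 := rfl
    let x : ℕ → ℝ := fun m => if h : m < g - 1 then
      α ⟨m, h⟩ * B.up m + B.graph.rval D (B.eu ⟨m, h⟩) else 0
    have hx : ∀ i : Fin (g - 1), x i.val = α i * B.up i.val + B.graph.rval D (B.eu i) := by
      intro i; simp [x]
    let F : B.graph.V → ℝ := fun v => match v with
      | Sum.inl (Sum.inl j) => ∑ m ∈ Finset.range j.val, x m
      | Sum.inl (Sum.inr i) => ∑ m ∈ Finset.range (i.val + 1), x m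
      | Sum.inr _ => 0
    have F_vv : ∀ j, F (B.vv j) = ∑ m ∈ Finset.range j.val, x m := fun _ => rfl
    have F_ww : ∀ i, F (B.ww i) = ∑ m ∈ Finset.range (i.val + 1), x m := fun _ => rfl
    have F_w : F B.w00 = 0 := rfl
    have F_d : ∀ i, F (B.ww i) - F (B.vv (BaseChainData.ix i)) = x i.val := by
      intro i
      rw [F_ww, F_vv, Finset.sum_range_succ]
      simp [BaseChainData.ix]
    refine ⟨a, F, ?_, ?_⟩
    · refine B.forallE ?_ ?_ ?_ ?_
      · intro i
        rw [B.src_eu, B.tgt_eu, F_d, hx, a_eu, B.len_eu]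
      · intro i
        rw [B.src_el, B.tgt_el, F_d, hx, a_el, B.len_el]
        have h1 := hk i
        rw [← hPpq i _ _ (hp i) (hq i) (hpq i), hP i] at h1
        have h4 := hLR i
        simp only [α]
        push_cast
        linear_combination B.up i.val * h4 - h1
      · intro j
        rw [B.tgt_eb, a_eb, hbR]
        rcases B.ix'_cases j with rfl | ⟨i, rfl⟩
        · rw [B.src_eb0, F_w, F_vv]; simp [BaseChainData.i0]
        · rw [B.src_eb', F_ww, F_vv]; simp [BaseChainData.ix']
      · rw [B.src_ec, B.tgt_ec, a_ec, hRc]; simp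
    · suffices h : ∀ v, D (B.pV v) - B.KDiv (B.pV v) =
          ∑ d ∈ B.graph.dartsAt v, if d.2 then a d.1 else -(a d.1 + B.graph.sdeg D d.1) from h
      refine B.forallV ?_ ?_ ?_
      · intro j
        rcases B.ix_cases j with rfl | ⟨i, rfl⟩
        · rw [B.darts_vl a (fun e => -(a e + B.graph.sdeg D e)), B.K_vv, hbS, a_ec, a_eb]
          omega
        · rw [B.darts_vv a (fun e => -(a e + B.graph.sdeg D e)), B.K_vv, hbS, a_eu, a_el, a_eb]
          simp only [α]; omega
      · intro i
        rw [B.darts_ww a (fun e => -(a e + B.graph.sdeg D e)), B.K_ww, a_eu, a_el, a_eb]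
        have := hL i
        simp only [α]; omega
      · rw [B.darts_w a (fun e => -(a e + B.graph.sdeg D e)), B.K_w, hw1, a_eb]
        omega
end

section
/- Let π: Γ̃ → Γ be a folded chain of loops with generic edge lengths, with Γ of genus g, and let P_ε(t) be a cell of the Prym–Brill–Noether locus V^r(Γ,π) corresponding to a Prym displacement tableau t of shape (r+1)×(r+1). Then dim P(t) ≤ g − 1 − C(r+1, 2). -/
open scoped ENNReal
/-! ### The folded chain of loops and its Prym–Brill–Noether theory -/

/-- Reduction of `x` modulo `C`. -/
noncomputable def redMod (C x : ℝ) : ℝ := x - C * ⌊x / C⌋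

lemma redMod_eq (C x : ℝ) (hC : C ≠ 0) : redMod C x = C * Int.fract (x / C) := by
  unfold redMod Int.fract
  rw [mul_sub, mul_div_cancel₀ _ hC]

lemma redMod_nonneg {C : ℝ} (hC : 0 < C) (x : ℝ) : 0 ≤ redMod C x := by
  rw [redMod_eq C x hC.ne']
  exact mul_nonneg hC.le (Int.fract_nonneg _)

lemma redMod_lt {C : ℝ} (hC : 0 < C) (x : ℝ) : redMod C x < C := by
  rw [redMod_eq C x hC.ne']
  calc C * Int.fract (x / C) < C * 1 := mul_lt_mul_of_pos_left (Int.fract_lt_one _) hC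
  _ = C := mul_one C

/-- `HasTorsion m C s₀`: a loop with a marked point at distance `m` (along one of
the two arcs) and circumference `C` has torsion `s₀`, i.e. `s·m` is an integer
multiple of `C` exactly when `s₀ ∣ s`; torsion `0` means `s·m` is never an
integer multiple of `C`. -/
def HasTorsion (m C : ℝ) (s₀ : ℕ) : Prop :=
  ∀ s : ℕ, 0 < s → ((∃ k : ℤ, (s : ℝ) * m = (k : ℝ) * C) ↔ s₀ ∣ s)

/-- A displacement tableau of shape `R × R` with symbols in `{1,…,2g-1}` and with
torsion function `tors` (cells are 1-indexed, in French notation): entries are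
strictly increasing along rows and columns, and equal symbols `n` occur only at
lattice distance divisible by the torsion of the `n`-th loop. -/
def IsDispTableau (g R : ℕ) (tors : ℕ → ℕ) (t : ℕ × ℕ → ℕ) : Prop :=
  (∀ a b, 1 ≤ a → a ≤ R → 1 ≤ b → b ≤ R → 1 ≤ t (a, b) ∧ t (a, b) ≤ 2 * g - 1) ∧
  (∀ a b, 1 ≤ a → a + 1 ≤ R → 1 ≤ b → b ≤ R → t (a, b) < t (a + 1, b)) ∧
  (∀ a b, 1 ≤ a → a ≤ R → 1 ≤ b → b + 1 ≤ R → t (a, b) < t (a, b + 1)) ∧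
  (∀ a b c d, 1 ≤ a → a ≤ R → 1 ≤ b → b ≤ R → 1 ≤ c → c ≤ R → 1 ≤ d → d ≤ R →
    t (a, b) = t (c, d) → tors (t (a, b)) ∣ (Nat.dist a c + Nat.dist b d))

/-- A Prym displacement tableau: a displacement tableau such that whenever
`t(a,b) = n` and `t(c,d) = 2g-n`, `a - b ≡ c - d (mod tors n)`. -/
def IsPrymTableau (g R : ℕ) (tors : ℕ → ℕ) (t : ℕ × ℕ → ℕ) : Prop :=
  IsDispTableau g R tors t ∧
  ∀ a b c d, 1 ≤ a → a ≤ R → 1 ≤ b → b ≤ R → 1 ≤ c → c ≤ R → 1 ≤ d → d ≤ R →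
    t (a, b) + t (c, d) = 2 * g →
    (tors (t (a, b)) : ℤ) ∣ (((a : ℤ) - b) - ((c : ℤ) - d))

/-- The torsion function of a folded chain of loops with generic edge lengths:
the middle loop has torsion `2` and all other loops have torsion `0`. -/
def torsGeneric (g : ℕ) : ℕ → ℕ := fun n => if n = g then 2 else 0

/-- The length data of a folded chain of loops `π : Γ̃ → Γ` over a base `Γ` of
genus `g`: `up i` (`i = 0, …, g-2`, 0-indexed) are the lengths of the upper arcs
of the loops `γ_1, …, γ_{g-1}` of `Γ` (lower arcs have length `1`), `c` is the
circumference of the last loop `γ_g` of `Γ` (equal to the length of each arc of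
the middle loop `γ̃_g` of `Γ̃`), and `bri i` are the bridge lengths. -/
structure FoldedChainData (g : ℕ) where
  hg : 2 ≤ g
  up : ℕ → ℝ
  c : ℝ
  bri : ℕ → ℝ
  up_pos : ∀ i, 0 < up i
  c_pos : 0 < c
  bri_pos : ∀ i, 0 < bri i

namespace FoldedChainData

variable {g : ℕ} (L : FoldedChainData g)

/-- Upper-arc length of the `i`-th loop (0-indexed, `i = 0, …, 2g-2`) of `Γ̃`:
the loops `γ̃_i` and `γ̃_{2g-i}` have the same edge lengths as `γ_i`, and each
arc of the middle loop has length `c`. -/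
noncomputable def upLen (i : ℕ) : ℝ :=
  if i = g - 1 then L.c else L.up (min i (2 * g - 2 - i))

/-- Lower-arc length of the `i`-th loop of `Γ̃`. -/
noncomputable def loLen (i : ℕ) : ℝ := if i = g - 1 then L.c else 1

/-- Circumference of the `i`-th loop of `Γ̃`. -/
noncomputable def circ (i : ℕ) : ℝ := L.upLen i + L.loLen i

lemma upLen_pos (i : ℕ) : 0 < L.upLen i := by
  unfold upLen
  split
  · exact L.c_pos
  · exact L.up_pos _

lemma loLen_pos (i : ℕ) : 0 < L.loLen i := by
  unfold loLen
  split
  · exact L.c_pos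
  · norm_num

lemma circ_pos (i : ℕ) : 0 < L.circ i := add_pos (L.upLen_pos i) (L.loLen_pos i)

/-- The folded chain of loops `Γ̃`, a chain of `2g-1` loops: vertices are the
tail vertices `ṽ_i` and head vertices `w̃_i` of the loops (`i = 0, …, 2g-2`,
0-indexed) together with the two extremal vertices `w̃₀` and `w̃_{2g}`; edges are
the upper and lower arcs of each loop, the bridges leading into each loop, and
the final pendant edge. -/
noncomputable def tGraph : MGraph where
  V := (Fin (2 * g - 1) ⊕ Fin (2 * g - 1)) ⊕ Fin 2
  E := (Fin (2 * g - 1) ⊕ Fin (2 * g - 1)) ⊕ (Fin (2 * g - 1) ⊕ Fin 1)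
  src := fun e => match e with
    | Sum.inl (Sum.inl i) => Sum.inl (Sum.inl i)
    | Sum.inl (Sum.inr i) => Sum.inl (Sum.inl i)
    | Sum.inr (Sum.inl i) =>
        if i.val = 0 then Sum.inr ⟨0, by norm_num⟩
        else Sum.inl (Sum.inr ⟨i.val - 1, by have := i.isLt; omega⟩)
    | Sum.inr (Sum.inr _) => Sum.inl (Sum.inr ⟨2 * g - 2, by have := L.hg; omega⟩)
  tgt := fun e => match e with
    | Sum.inl (Sum.inl i) => Sum.inl (Sum.inr i)
    | Sum.inl (Sum.inr i) => Sum.inl (Sum.inr i)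
    | Sum.inr (Sum.inl i) => Sum.inl (Sum.inl i)
    | Sum.inr (Sum.inr _) => Sum.inr ⟨1, by norm_num⟩
  len := fun e => match e with
    | Sum.inl (Sum.inl i) => L.upLen i.val
    | Sum.inl (Sum.inr i) => L.loLen i.val
    | Sum.inr (Sum.inl i) => L.bri (min i.val (2 * g - 1 - i.val))
    | Sum.inr (Sum.inr _) => L.bri 0
  len_pos := fun e => match e with
    | Sum.inl (Sum.inl i) => L.upLen_pos i.val
    | Sum.inl (Sum.inr i) => L.loLen_pos i.val
    | Sum.inr (Sum.inl i) => L.bri_pos _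
    | Sum.inr (Sum.inr _) => L.bri_pos 0

/-- The head vertex `w̃_{2g-1}` of the last loop, as a point of `Γ̃`. -/
noncomputable def lastHead : L.tGraph.Pt :=
  Sum.inl (Sum.inl (Sum.inr ⟨2 * g - 2, by have := L.hg; omega⟩))

/-- The point of `Γ̃` at counterclockwise distance `x` (taken modulo the
circumference) from the head vertex `w̃_n` of the `n`-th loop; counterclockwise
means along the upper arc towards `ṽ_n` first. -/
noncomputable def chipPt (n : Fin (2 * g - 1)) (x : ℝ) : L.tGraph.Pt :=
  if hy : redMod (L.circ n.val) x = 0 then Sum.inl (Sum.inl (Sum.inr n))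
  else if h1 : redMod (L.circ n.val) x < L.upLen n.val then
    Sum.inr ⟨Sum.inl (Sum.inl n), ⟨L.upLen n.val - redMod (L.circ n.val) x, by
      have h0 : 0 < redMod (L.circ n.val) x :=
        lt_of_le_of_ne (redMod_nonneg (L.circ_pos n.val) x) (Ne.symm hy)
      constructor
      · linarith
      · show L.upLen n.val - redMod (L.circ n.val) x < L.upLen n.val
        linarith⟩⟩
  else if h2 : redMod (L.circ n.val) x = L.upLen n.val then
    Sum.inl (Sum.inl (Sum.inl n))
  else
    Sum.inr ⟨Sum.inl (Sum.inr n), ⟨redMod (L.circ n.val) x - L.upLen n.val, by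
      have hlt : redMod (L.circ n.val) x < L.circ n.val := redMod_lt (L.circ_pos n.val) x
      have hge : L.upLen n.val < redMod (L.circ n.val) x :=
        lt_of_le_of_ne (not_lt.mp h1) (fun h => h2 h.symm)
      constructor
      · linarith
      · show redMod (L.circ n.val) x - L.upLen n.val < L.loLen n.val
        have : L.circ n.val = L.upLen n.val + L.loLen n.val := rfl
        linarith⟩⟩

/-- The canonical representative divisor of the class with coordinates `ξ`: one
chip on each loop, at counterclockwise distance `⟨ξ⟩_n` from the head vertex
`w̃_n` of the `n`-th loop, and a pole at the last head vertex `w̃_{2g-1}`. -/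
noncomputable def canonRep (xi : Fin (2 * g - 1) → ℝ) : L.tGraph.DivT :=
  (∑ n : Fin (2 * g - 1), Finsupp.single (L.chipPt n (xi n)) 1)
    - Finsupp.single L.lastHead 1

/-- The symmetry condition on coordinates characterizing Prym classes (classes
with norm the canonical class): `⟨ξ⟩_i = ⟨ξ⟩_{2g-i}` for all `i ≠ g`. -/
def PrymCoords (xi : Fin (2 * g - 1) → ℝ) : Prop :=
  ∀ n m : Fin (2 * g - 1), (n : ℕ) + (m : ℕ) = 2 * g - 2 →
    ∃ k : ℤ, xi n - xi m = (k : ℝ) * L.circ n.val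

/-- The parity condition `⟨ξ⟩_g = -ε`: odd classes (`ε = 0`) have their chip at
the head vertex `w̃_g` of the middle loop, even classes (`ε = -1`) have it at
distance `1`. -/
def ParityCoords (eps : ℤ) (xi : Fin (2 * g - 1) → ℝ) : Prop :=
  ∀ n : Fin (2 * g - 1), (n : ℕ) = g - 1 →
    ∃ k : ℤ, xi n = -(eps : ℝ) + (k : ℝ) * L.circ n.val

/-- The parity component `V^ε(Γ,π)` (`ε ∈ {-1,0}`) of the tropical
Prym–Brill–Noether locus `V(Γ,π) = Nm_π^{-1}[K_Γ]`, in the coordinates given by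
the canonical representatives. -/
def Veps (eps : ℤ) : Set (Fin (2 * g - 1) → ℝ) :=
  {xi | L.PrymCoords xi ∧ L.ParityCoords eps xi}

/-- The tropical Prym–Brill–Noether locus `V^r(Γ,π)`: Prym classes of parity
`ε ≡ r (mod 2)` and Baker–Norine rank at least `r`. -/
noncomputable def Vr (r : ℤ) : Set (Fin (2 * g - 1) → ℝ) :=
  {xi | L.PrymCoords xi ∧ L.ParityCoords (if (2 : ℤ) ∣ r then 0 else -1) xi ∧
    r ≤ L.tGraph.bnRank (L.canonRep xi)}

/-- The coordinate locus `T(t)` cut out by a displacement tableau `t` of shape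
`R × R`: the symbol `n` in cell `(a,b)` places the chip of the `n`-th loop at
counterclockwise distance `b - a` from its head vertex; chips of unused loops
are arbitrary. -/
def cellT (R : ℕ) (t : ℕ × ℕ → ℕ) : Set (Fin (2 * g - 1) → ℝ) :=
  {xi | ∀ a b, 1 ≤ a → a ≤ R → 1 ≤ b → b ≤ R →
    ∀ n : Fin (2 * g - 1), (n : ℕ) + 1 = t (a, b) →
      ∃ k : ℤ, xi n = ((b : ℝ) - (a : ℝ)) + (k : ℝ) * L.circ n.val}

/-- The Prym–Brill–Noether cell `P_ε(t)`: the Prym divisor classes of parity `ε`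
in `T(t)`. -/
def cellP (R : ℕ) (eps : ℤ) (t : ℕ × ℕ → ℕ) : Set (Fin (2 * g - 1) → ℝ) :=
  L.cellT R t ∩ L.Veps eps

/-- Generic edge lengths: every loop of `Γ̃` other than the middle one has
torsion `0`; the middle loop always has torsion `2`. -/
def GenericLengths : Prop :=
  (∀ i : ℕ, i < 2 * g - 1 → i ≠ g - 1 → HasTorsion 1 (L.circ i) 0) ∧
  HasTorsion L.c (L.circ (g - 1)) 2

end FoldedChainData

/-- A set whose coordinates are, up to countable ambiguity, determined by the coordinates
in `F` has dimension at most the cardinality of `F`. -/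
lemma dimH_le_of_coords {ι : Type} [Fintype ι] (F : Finset ι) (f : ι → Option F)
    (C : ι → Set ℝ) (hC : ∀ n, (C n).Countable) (S : Set (ι → ℝ))
    (hS : ∀ x ∈ S, ∀ n, x n - (f n).elim 0 (fun m => x m) ∈ C n) :
    dimH S ≤ (F.card : ℝ≥0∞) := by
  have hcount : (Set.univ.pi C).Countable := Set.countable_univ_pi hC
  let φ : (ι → ℝ) → (F → ℝ) → (ι → ℝ) := fun c y n => c n + (f n).elim 0 (fun m => y m)
  have hsub : S ⊆ ⋃ c ∈ Set.univ.pi C, Set.range (φ c) := by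
    intro x hx
    simp only [Set.mem_iUnion]
    refine ⟨fun n => x n - (f n).elim 0 (fun m => x m), fun n _ => hS x hx n,
      fun m => x m, ?_⟩
    funext n
    simp [φ]
  refine (dimH_mono hsub).trans ?_
  rw [dimH_bUnion hcount]
  refine iSup₂_le fun c _ => ?_
  have hcd : ContDiff ℝ 1 (φ c) := by
    rw [contDiff_pi]
    intro n
    rcases h : f n with _ | m
    · simpa [φ, h] using contDiff_const
    · simp only [φ, h, Option.elim]
      exact contDiff_const.add (contDiff_apply ℝ ℝ m)
  refine hcd.dimH_range_le.trans ?_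
  simp

/-- The set of used symbol classes `{u, 2g-u}`, `1 ≤ u ≤ g-1`. -/
noncomputable def usedClasses (g R : ℕ) (t : ℕ × ℕ → ℕ) : Finset ℕ :=
  open Classical in
  (Finset.Icc 1 (g - 1)).filter (fun u => ∃ a b, 1 ≤ a ∧ a ≤ R ∧ 1 ≤ b ∧ b ≤ R ∧
    (t (a, b) = u ∨ t (a, b) + u = 2 * g))

lemma tableau_le {g R : ℕ} {tors : ℕ → ℕ} {t : ℕ × ℕ → ℕ} (ht : IsDispTableau g R tors t)
    (a b : ℕ) (ha : 1 ≤ a) (hb : 1 ≤ b) (k : ℕ) (ha' : a + k ≤ R) (hb' : b + k ≤ R) :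
    t (a, b) + k ≤ t (a + k, b + k) := by
  obtain ⟨-, h1, h2, -⟩ := ht
  induction k with
  | zero => simp
  | succ k ih =>
    have e1 := ih (by omega) (by omega)
    have e2 := h1 (a + k) (b + k) (by omega) (by omega) (by omega) (by omega)
    have e3 := h2 (a + k + 1) (b + k) (by omega) (by omega) (by omega) (by omega)
    have e4 : t (a + (k + 1), b + (k + 1)) = t (a + k + 1, b + k + 1) := rfl
    omega

lemma choose_le_usedClasses {g R : ℕ} {t : ℕ × ℕ → ℕ}
    (ht : IsPrymTableau g R (torsGeneric g) t) :
    R.choose 2 ≤ (usedClasses g R t).card := by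
  classical
  obtain ⟨hd, hp⟩ := ht
  have hdiag := tableau_le hd
  obtain ⟨hb, -, -, htor⟩ := hd
  -- cells of the half square
  let H : Finset ((_ : ℕ) × ℕ) := (Finset.range R).sigma (fun i => Finset.range i)
  have hH : H.card = R.choose 2 := by
    simp [H, Finset.card_sigma, Finset.sum_range_id, Nat.choose_two_right]
  rw [← hH]
  let P : ℤ → Prop := fun δ => ∀ a b : ℕ, 1 ≤ a → 1 ≤ b → a + b ≤ R → (a : ℤ) - b = δ →
    t (a, b) < g
  let A : ((_ : ℕ) × ℕ) → ℕ := fun x => x.2 + 1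
  let B : ((_ : ℕ) × ℕ) → ℕ := fun x => R - x.1
  let φ : ((_ : ℕ) × ℕ) → ℕ × ℕ := fun x =>
    if P ((A x : ℤ) - B x) then (A x, B x) else (R + 1 - B x, R + 1 - A x)
  have hmem : ∀ x ∈ H, 1 ≤ A x ∧ 1 ≤ B x ∧ A x + B x ≤ R := by
    intro x hx
    simp only [H, Finset.mem_sigma, Finset.mem_range] at hx
    simp only [A, B]
    omega
  have hφ : ∀ x ∈ H, 1 ≤ (φ x).1 ∧ (φ x).1 ≤ R ∧ 1 ≤ (φ x).2 ∧ (φ x).2 ≤ R ∧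
      ((φ x).1 : ℤ) - (φ x).2 = (A x : ℤ) - B x ∧
      ((P ((A x : ℤ) - B x) ∧ φ x = (A x, B x) ∧ t (φ x) < g) ∨
       (¬ P ((A x : ℤ) - B x) ∧ φ x = (R + 1 - B x, R + 1 - A x) ∧ g < t (φ x))) := by
    intro x hx
    obtain ⟨h1, h2, h3⟩ := hmem x hx
    by_cases hP : P ((A x : ℤ) - B x)
    · have e : φ x = (A x, B x) := if_pos hP
      rw [e]
      refine ⟨h1, by simp only; omega, h2, by simp only; omega, rfl, Or.inl ⟨hP, rfl, ?_⟩⟩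
      exact hP _ _ h1 h2 h3 rfl
    · have e : φ x = (R + 1 - B x, R + 1 - A x) := if_neg hP
      rw [e]
      refine ⟨by simp only; omega, by simp only; omega, by simp only; omega,
        by simp only; omega, by simp only; omega, Or.inr ⟨hP, rfl, ?_⟩⟩
      simp only [P] at hP
      push Not at hP
      obtain ⟨a, b, ha, hb1, hab, hδ, hge⟩ := hP
      have := hdiag a b ha hb1 (R + 1 - B x - a) (by omega) (by omega)
      have e1 : a + (R + 1 - B x - a) = R + 1 - B x := by omega
      have e2 : b + (R + 1 - B x - a) = R + 1 - A x := by omega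
      rw [e1, e2] at this
      omega
  have hbd : ∀ x ∈ H, 1 ≤ t (φ x) ∧ t (φ x) ≤ 2 * g - 1 := fun x hx => by
    obtain ⟨h1, h2, h3, h4, -⟩ := hφ x hx
    exact hb _ _ h1 h2 h3 h4
  refine Finset.card_le_card_of_injOn (fun x => min (t (φ x)) (2 * g - t (φ x))) ?_ ?_
  · intro x hx
    obtain ⟨h1, h2, h3, h4, -, h6⟩ := hφ x hx
    have h7 := hbd x hx
    have hne : t (φ x) ≠ g := by
      rcases h6 with h | h <;> omega
    simp only [usedClasses, Finset.coe_filter, Set.mem_setOf_eq, Finset.mem_Icc]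
    refine ⟨by omega, (φ x).1, (φ x).2, h1, h2, h3, h4, ?_⟩
    simp only [Prod.mk.eta]
    omega
  · intro x hx y hy hxy
    obtain ⟨h1, h2, h3, h4, h5, h6⟩ := hφ x hx
    obtain ⟨k1, k2, k3, k4, k5, k6⟩ := hφ y hy
    have h7 := hbd x hx
    have k7 := hbd y hy
    obtain ⟨h8, h9, h10⟩ := hmem x hx
    obtain ⟨k8, k9, k10⟩ := hmem y hy
    have hne : t (φ x) ≠ g := by
      rcases h6 with h | h <;> omega
    have hcases : t (φ x) = t (φ y) ∨ t (φ x) + t (φ y) = 2 * g := by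
      simp only at hxy
      omega
    have same : t (φ x) = t (φ y) → φ x = φ y := by
      intro h
      have := htor (φ x).1 (φ x).2 (φ y).1 (φ y).2 h1 h2 h3 h4 k1 k2 k3 k4 h
      simp only [Prod.mk.eta, torsGeneric, if_neg hne, zero_dvd_iff, Nat.dist] at this
      ext <;> omega
    have hδ : (A x : ℤ) - B x = (A y : ℤ) - B y := by
      rcases hcases with h | h
      · rw [← h5, ← k5, same h]
      · have := hp (φ x).1 (φ x).2 (φ y).1 (φ y).2 h1 h2 h3 h4 k1 k2 k3 k4 h
        simp only [Prod.mk.eta, torsGeneric, if_neg hne, Nat.cast_zero, zero_dvd_iff] at this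
        omega
    have hAB : A x = A y ∧ B x = B y := by
      rcases h6 with ⟨p, q, u⟩ | ⟨p, q, u⟩ <;> rcases k6 with ⟨p', q', u'⟩ | ⟨p', q', u'⟩
      · have := same (by omega)
        rw [q, q', Prod.mk.injEq] at this
        exact this
      · rw [hδ] at p; exact absurd p p'
      · rw [hδ] at p; exact absurd p' p
      · have := same (by omega)
        rw [q, q', Prod.mk.injEq] at this
        omega
    simp only [H, Finset.coe_sigma, Finset.mem_coe, Set.mem_sigma_iff,
      Finset.mem_range] at hx hy
    obtain ⟨x1, x2⟩ := x
    obtain ⟨y1, y2⟩ := y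
    simp only [A, B] at hAB hx hy
    have e1 : x1 = y1 := by omega
    have e2 : x2 = y2 := by omega
    subst e1 e2
    rfl

/-!
Statement 12: upper bound on the dimension of a Prym–Brill–Noether cell.
For a folded chain of loops with generic edge lengths and a Prym displacement
tableau `t` of shape `(r+1) × (r+1)`, the cell `P(t) = P_{-1}(t) ∪ P_0(t)` has
(Hausdorff) dimension at most `g - 1 - C(r+1, 2)`.
-/

theorem prym_BN_cell_dimension_upper_bound
    (g : ℕ) (L : FoldedChainData g) (hgen : L.GenericLengths)
    (r : ℤ) (hr : -1 ≤ r)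
    (t : ℕ × ℕ → ℕ) (ht : IsPrymTableau g (r + 1).toNat (torsGeneric g) t) :
    dimH (L.cellP (r + 1).toNat (-1) t ∪ L.cellP (r + 1).toNat 0 t)
      ≤ ((g - 1 - (r + 1).toNat.choose 2 : ℕ) : ℝ≥0∞) := by
  classical
  set R := (r + 1).toNat with hR
  have hg := L.hg
  have hcard := choose_le_usedClasses ht
  have hmid : ∀ n : Fin (2 * g - 1), 2 * g - 2 - (n : ℕ) < 2 * g - 1 := fun n => by omega
  let σ : Fin (2 * g - 1) → Fin (2 * g - 1) := fun n => ⟨2 * g - 2 - n, hmid n⟩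
  let F : Finset (Fin (2 * g - 1)) :=
    Finset.univ.filter (fun n => (n : ℕ) + 1 < g ∧ (n : ℕ) + 1 ∉ usedClasses g R t)
  have hF : F.card ≤ g - 1 - R.choose 2 := by
    have h1 : F.card ≤ ((Finset.Icc 1 (g - 1)) \ usedClasses g R t).card := by
      refine Finset.card_le_card_of_injOn (fun n => (n : ℕ) + 1) ?_ ?_
      · intro n hn
        simp only [F, Finset.coe_filter, Finset.mem_univ, true_and, Set.mem_setOf_eq] at hn
        simp only [Finset.coe_sdiff, Set.mem_sdiff, Finset.mem_coe, Finset.mem_Icc]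
        exact ⟨by omega, hn.2⟩
      · intro n _ m _ h
        simp only at h
        exact Fin.ext (by omega)
    have h2 : usedClasses g R t ⊆ Finset.Icc 1 (g - 1) := Finset.filter_subset _ _
    rw [Finset.card_sdiff_of_subset h2, Nat.card_Icc] at h1
    omega
  let f : Fin (2 * g - 1) → Option F := fun n =>
    if h : n ∈ F then some ⟨n, h⟩ else if h : σ n ∈ F then some ⟨σ n, h⟩ else none
  let C : Fin (2 * g - 1) → Set ℝ := fun n => Set.range (fun q : ℤ × ℤ × ℤ =>
    (q.1 : ℝ) + q.2.1 * L.circ n + q.2.2 * L.circ (σ n))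
  refine (dimH_le_of_coords F f C (fun n => Set.countable_range _) _ ?_).trans
    (by exact_mod_cast hF)
  have key : ∀ eps : ℤ, ∀ x ∈ L.cellP R eps t, ∀ n,
      x n - (f n).elim 0 (fun m => x m) ∈ C n := by
    rintro eps x ⟨hT, hPr, hPa⟩ n
    have hn := n.isLt
    by_cases h1 : n ∈ F
    · have e : f n = some ⟨n, h1⟩ := dif_pos h1
      rw [e]
      exact ⟨(0, 0, 0), by simp⟩
    by_cases h2 : σ n ∈ F
    · have e : f n = some ⟨σ n, h2⟩ := by simp only [f, dif_neg h1, dif_pos h2]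
      rw [e]
      obtain ⟨k, hk⟩ := hPr n (σ n) (by simp only [σ]; omega)
      exact ⟨(0, k, 0), by simp [hk]⟩
    have e : f n = none := by simp only [f, dif_neg h1, dif_neg h2]
    rw [e]
    simp only [Option.elim, sub_zero]
    by_cases hm : (n : ℕ) = g - 1
    · obtain ⟨k, hk⟩ := hPa n hm
      exact ⟨(-eps, k, 0), by simp [hk]⟩
    have hused : ∃ a b, 1 ≤ a ∧ a ≤ R ∧ 1 ≤ b ∧ b ≤ R ∧
        ((n : ℕ) + 1 = t (a, b) ∨ ((σ n : Fin _) : ℕ) + 1 = t (a, b)) := by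
      simp only [F, Finset.mem_filter, Finset.mem_univ, true_and, not_and, not_not] at h1 h2
      rcases lt_or_gt_of_ne hm with hlt | hlt
      · have := h1 (by omega)
        simp only [usedClasses, Finset.mem_filter] at this
        obtain ⟨-, a, b, ha, ha', hb, hb', h⟩ := this
        refine ⟨a, b, ha, ha', hb, hb', ?_⟩
        simp only [σ]
        omega
      · have := h2 (by simp only [σ]; omega)
        simp only [usedClasses, Finset.mem_filter] at this
        obtain ⟨-, a, b, ha, ha', hb, hb', h⟩ := this
        refine ⟨a, b, ha, ha', hb, hb', ?_⟩
        simp only [σ] at h ⊢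
        omega
    obtain ⟨a, b, ha, ha', hb, hb', h | h⟩ := hused
    · obtain ⟨k, hk⟩ := hT a b ha ha' hb hb' n h
      exact ⟨((b : ℤ) - a, k, 0), by simp [hk]⟩
    · obtain ⟨k, hk⟩ := hT a b ha ha' hb hb' (σ n) h
      obtain ⟨l, hl⟩ := hPr n (σ n) (by simp only [σ]; omega)
      refine ⟨((b : ℤ) - a, l, k), ?_⟩
      push_cast
      linarith
  rintro x (hx | hx)
  · exact key _ x hx
  · exact key _ x hx
end

section
/- Let r ≥ 0 and let k ≥ 2 be an integer that is either even or greater than 2r − 2, and set ℓ = ⌈k/2⌉. Consider fillings of the lower-triangular staircase diagram consisting of the cells (a,b) with a, b ≥ 1 and a + b < r + 2 (rows of lengths r, r−1, …, 1 in French notation) by positive integers, strictly increasing along rows and columns, such that any two cells carrying the same entry have lattice distance divisible by k (a k-uniform lower triangular tableau). Then the minimal number of distinct entries appearing in such a filling equals n(r,ℓ). -/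
/-!
Statement 15: the minimal number of distinct entries in a `k`-uniform lower
triangular (staircase) tableau equals `n(r,ℓ)` with `ℓ = ⌈k/2⌉`.

Cells are 1-indexed in French notation: the staircase diagram consists of the
cells `(a,b)` with `a, b ≥ 1` and `a + b < r + 2` (rows of lengths `r, r-1, …, 1`).
-/

/-- `n(r,ℓ)`: equals `C(ℓ+1,2) + ℓ(r-ℓ)` if `ℓ ≤ r-1`, and `C(r+1,2)` otherwise.
(For `ℓ ≥ 1`, the natural-number truncation in `r - 1` is harmless.) -/
def nval (r l : ℕ) : ℕ :=
  if l ≤ r - 1 ∧ 1 ≤ r then Nat.choose (l + 1) 2 + l * (r - l) else Nat.choose (r + 1) 2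

/-- The lower triangular staircase diagram with rows `r, r-1, …, 1`, as a finset
of 1-indexed cells `(a,b)` (`a` the column, `b` the row) with `a + b < r + 2`. -/
def staircase (r : ℕ) : Finset (ℕ × ℕ) :=
  (Finset.Icc 1 r ×ˢ Finset.Icc 1 r).filter fun p => p.1 + p.2 < r + 2

/-- A `k`-uniform lower triangular tableau: a filling of the staircase with rows
`r, r-1, …, 1` by positive integers, strictly increasing along rows and columns,
such that any two cells carrying the same entry have lattice distance divisible
by `k`. -/
def IsKUniformLowerTriangular (r k : ℕ) (t : ℕ × ℕ → ℕ) : Prop :=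
  (∀ p ∈ staircase r, 1 ≤ t p) ∧
  (∀ a b : ℕ, (a, b) ∈ staircase r → (a + 1, b) ∈ staircase r → t (a, b) < t (a + 1, b)) ∧
  (∀ a b : ℕ, (a, b) ∈ staircase r → (a, b + 1) ∈ staircase r → t (a, b) < t (a, b + 1)) ∧
  (∀ p q, p ∈ staircase r → q ∈ staircase r → t p = t q →
    k ∣ (Nat.dist p.1 q.1 + Nat.dist p.2 q.2))


/-- The cells whose content lies in the window `(-l, l]`. -/
def band (r l : ℕ) : Finset (ℕ × ℕ) :=
  (staircase r).filter fun p => p.1 ≤ p.2 + l ∧ p.2 < p.1 + l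

theorem mem_staircase' (r a b : ℕ) :
    (a, b) ∈ staircase r ↔ 1 ≤ a ∧ 1 ≤ b ∧ a + b < r + 2 := by
  simp only [staircase, Finset.mem_filter, Finset.mem_product, Finset.mem_Icc]
  omega

theorem mem_band' (r l a b : ℕ) :
    (a, b) ∈ band r l ↔ (1 ≤ a ∧ 1 ≤ b ∧ a + b < r + 2) ∧ a ≤ b + l ∧ b < a + l := by
  simp only [band, Finset.mem_filter, mem_staircase']

theorem band_card_succ (r l : ℕ) (hl : 1 ≤ l) :
    (band (r + 1) l).card = (band r l).card + min (r + 1) l := by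
  have h : band (r + 1) l = band r l ∪
      (Finset.Icc (max 1 ((r + 2 - l) / 2 + (if l ≤ r + 2 then 1 else 0)))
        (min (r + 1) ((r + 2 + l) / 2))).image
        (fun a => (a, r + 2 - a)) := by
    ext ⟨a, b⟩
    simp only [Finset.mem_union, mem_band', Finset.mem_image, Finset.mem_Icc, Prod.mk.injEq]
    constructor
    · intro h
      by_cases h2 : a + b < r + 2
      · left; omega
      · right
        refine ⟨a, ?_, rfl, by omega⟩
        split_ifs <;> omega
    · rintro (h | ⟨x, hx, rfl, rfl⟩)
      · omega
      · split_ifs at hx <;> omega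
  rw [h, Finset.card_union_of_disjoint, Finset.card_image_of_injOn, Nat.card_Icc]
  · congr 1
    split_ifs <;> omega
  · intro x _ y _ hxy
    simpa using congrArg Prod.fst hxy
  · rw [Finset.disjoint_left]
    rintro ⟨a, b⟩ h1 h2
    simp only [mem_band', Finset.mem_image, Finset.mem_Icc, Prod.mk.injEq] at h1 h2
    obtain ⟨x, hx, rfl, rfl⟩ := h2
    omega

theorem nval_succ (r l : ℕ) (hl : 1 ≤ l) :
    nval (r + 1) l = nval r l + min (r + 1) l := by
  unfold nval
  have h1 := Nat.choose_succ_succ (r + 1) 1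
  simp only [Nat.choose_one_right] at h1
  rcases lt_trichotomy l r with h | h | h
  · rw [if_pos (by omega), if_pos (by omega), show r + 1 - l = (r - l) + 1 by omega,
      min_eq_right (by omega)]
    ring
  · subst h
    rw [if_pos (by omega), if_neg (by omega), show l + 1 - l = 1 by omega,
      min_eq_right (by omega)]
    ring
  · rw [if_neg (by omega), if_neg (by omega), min_eq_left (by omega)]
    have : (r + 1 + 1).choose 2 = r + 1 + (r + 1).choose 2 := h1
    omega

theorem band_card (r l : ℕ) (hl : 1 ≤ l) : (band r l).card = nval r l := by
  induction r with
  | zero =>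
    have : band 0 l = ∅ := by
      ext ⟨a, b⟩
      simp only [mem_band', Finset.notMem_empty, iff_false]
      omega
    rw [this]
    simp [nval]
  | succ r ih => rw [band_card_succ r l hl, nval_succ r l hl, ih]

theorem mono_row {r k : ℕ} {t : ℕ × ℕ → ℕ} (h : IsKUniformLowerTriangular r k t)
    (a b n : ℕ) (h1 : (a, b) ∈ staircase r) (h2 : (a + n, b) ∈ staircase r) :
    t (a, b) + n ≤ t (a + n, b) := by
  induction n with
  | zero => simp
  | succ n ih =>
    have h3 : (a + n, b) ∈ staircase r := by
      rw [mem_staircase'] at *; omega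
    have := h.2.1 (a + n) b h3 h2
    have := ih h3
    rw [show a + (n + 1) = a + n + 1 by ring]
    omega

theorem mono_col {r k : ℕ} {t : ℕ × ℕ → ℕ} (h : IsKUniformLowerTriangular r k t)
    (a b n : ℕ) (h1 : (a, b) ∈ staircase r) (h2 : (a, b + n) ∈ staircase r) :
    t (a, b) + n ≤ t (a, b + n) := by
  induction n with
  | zero => simp
  | succ n ih =>
    have h3 : (a, b + n) ∈ staircase r := by
      rw [mem_staircase'] at *; omega
    have := h.2.2.1 a (b + n) h3 h2
    have := ih h3
    rw [show b + (n + 1) = b + n + 1 by ring]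
    omega

theorem mono_both {r k : ℕ} {t : ℕ × ℕ → ℕ} (h : IsKUniformLowerTriangular r k t)
    (a b c d : ℕ) (h1 : (a, b) ∈ staircase r) (h2 : (c, d) ∈ staircase r)
    (hac : a ≤ c) (hbd : b ≤ d) (heq : t (a, b) = t (c, d)) : a = c ∧ b = d := by
  obtain ⟨m, rfl⟩ := Nat.exists_eq_add_of_le hac
  obtain ⟨n, rfl⟩ := Nat.exists_eq_add_of_le hbd
  have h3 : (a + m, b) ∈ staircase r := by
    rw [mem_staircase'] at *; omega
  have := mono_row h a b m h1 h3
  have := mono_col h (a + m) b n h3 h2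
  omega

theorem injOn_band {r k : ℕ} {t : ℕ × ℕ → ℕ}
    (hkk : Even k ∨ (2 * (r : ℤ) - 2 < (k : ℤ)))
    (h : IsKUniformLowerTriangular r k t) :
    Set.InjOn t (band r ((k + 1) / 2)) := by
  rintro ⟨a, b⟩ hp ⟨c, d⟩ hq heq
  rw [Finset.mem_coe, mem_band'] at hp hq
  have h1 : (a, b) ∈ staircase r := (mem_staircase' _ _ _).2 hp.1
  have h2 : (c, d) ∈ staircase r := (mem_staircase' _ _ _).2 hq.1
  have hd := h.2.2.2 _ _ h1 h2 heq
  by_cases h3 : a ≤ c ∧ b ≤ d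
  · have := mono_both h a b c d h1 h2 h3.1 h3.2 heq
    rw [this.1, this.2]
  by_cases h4 : c ≤ a ∧ d ≤ b
  · have := mono_both h c d a b h2 h1 h4.1 h4.2 heq.symm
    rw [this.1, this.2]
  exfalso
  simp only [Nat.dist] at hd
  have := Nat.le_of_dvd (by omega) hd
  rcases hkk with ⟨m, rfl⟩ | hkk <;> omega

/-- The optimal tableau. -/
def optT (k : ℕ) (p : ℕ × ℕ) : ℕ := (p.1 + p.2) * k + (((p.1 : ℤ) - p.2) % k).toNat

theorem optT_lt {k : ℕ} (hk : 2 ≤ k) (p q : ℕ × ℕ) (h : p.1 + p.2 < q.1 + q.2) :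
    optT k p < optT k q := by
  unfold optT
  have h1 := Int.emod_lt_of_pos ((p.1 : ℤ) - p.2) (show (0 : ℤ) < k by omega)
  have h2 : (p.1 + p.2 + 1) * k ≤ (q.1 + q.2) * k := Nat.mul_le_mul_right _ h
  rw [add_mul] at h2
  omega

theorem optT_eq {k : ℕ} (hk : 2 ≤ k) (p q : ℕ × ℕ) (h : optT k p = optT k q) :
    p.1 + p.2 = q.1 + q.2 ∧ ((k : ℤ) ∣ ((q.1 : ℤ) - q.2) - ((p.1 : ℤ) - p.2)) := by
  have hs : p.1 + p.2 = q.1 + q.2 := by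
    rcases lt_trichotomy (p.1 + p.2) (q.1 + q.2) with h' | h' | h'
    · have := optT_lt hk p q h'; omega
    · exact h'
    · have := optT_lt hk q p h'; omega
  refine ⟨hs, ?_⟩
  unfold optT at h
  rw [hs] at h
  have h1 := Int.emod_nonneg ((p.1 : ℤ) - p.2) (show (k : ℤ) ≠ 0 by omega)
  have h2 := Int.emod_nonneg ((q.1 : ℤ) - q.2) (show (k : ℤ) ≠ 0 by omega)
  exact (Int.ModEq.dvd (show _ % _ = _ % _ by omega))

theorem optT_uniform {r k : ℕ} (hk : 2 ≤ k) : IsKUniformLowerTriangular r k (optT k) := by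
  refine ⟨?_, ?_, ?_, ?_⟩
  · rintro ⟨a, b⟩ hp
    rw [mem_staircase'] at hp
    have : 0 < (a + b) * k := Nat.mul_pos (by omega) (by omega)
    simp only [optT]
    omega
  · intro a b _ _
    exact optT_lt hk _ _ (by simp only; omega)
  · intro a b _ _
    exact optT_lt hk _ _ (by simp only; omega)
  · rintro ⟨a, b⟩ ⟨c, d⟩ _ _ heq
    obtain ⟨h1, h2⟩ := optT_eq hk _ _ heq
    simp only at h1 h2
    rw [← Int.natCast_dvd_natCast]
    simp only [Nat.dist]
    rcases le_total a c with h | h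
    · rwa [show ((a - c + (c - a) + (b - d + (d - b)) : ℕ) : ℤ) = (c : ℤ) - d - (a - b) by omega]
    · rw [show ((a - c + (c - a) + (b - d + (d - b)) : ℕ) : ℤ) = -((c : ℤ) - d - (a - b)) by omega]
      exact (dvd_neg).2 h2

theorem optT_image {r k : ℕ} (hk : 2 ≤ k) (hkk : Even k ∨ (2 * (r : ℤ) - 2 < (k : ℤ))) :
    (staircase r).image (optT k) = (band r ((k + 1) / 2)).image (optT k) := by
  apply Finset.Subset.antisymm
  · intro x hx
    rw [Finset.mem_image] at hx ⊢
    obtain ⟨⟨a, b⟩, hp, rfl⟩ := hx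
    rw [mem_staircase'] at hp
    rcases hkk with ⟨l, rfl⟩ | hkk
    · have e : (l + l + 1) / 2 = l := by omega
      rw [e]
      have h1 := Int.emod_nonneg ((l : ℤ) - (a - b)) (show (2 * l : ℤ) ≠ 0 by omega)
      have h2 := Int.emod_lt_of_pos ((l : ℤ) - (a - b)) (show (0 : ℤ) < 2 * l by omega)
      have h3 := Int.emod_add_mul_ediv ((l : ℤ) - (a - b)) (2 * l)
      generalize ((l : ℤ) - (a - b)) % (2 * l) = m at *
      generalize ((l : ℤ) - (a - b)) / (2 * l) = j at *
      rw [mul_assoc] at h3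
      -- the shift is a multiple of `l`
      have hz : (l : ℤ) * j = 0 ∨ (l : ℤ) ≤ l * j ∨ (l : ℤ) * j ≤ - l := by
        rcases lt_trichotomy j 0 with h | h | h
        · right; right; nlinarith
        · left; simp [h]
        · right; left; nlinarith
      obtain ⟨z, hzz⟩ : ∃ z : ℤ, z = (l : ℤ) * j := ⟨_, rfl⟩
      rw [← hzz] at h3 hz
      refine ⟨((a + z).toNat, (b - z).toNat), ?_, ?_⟩
      · rw [mem_band']
        omega
      · simp only [optT]
        have ha : ((a + z).toNat : ℤ) = a + z := by omega
        have hb : ((b - z).toNat : ℤ) = b - z := by omega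
        have hs : (a + z).toNat + (b - z).toNat = a + b := by omega
        rw [hs, ha, hb, show (a : ℤ) + z - (b - z) = (a - b) + ((l + l : ℕ) : ℤ) * j by
          rw [hzz]; push_cast; ring, Int.add_mul_emod_self_left]
    · refine ⟨(a, b), ?_, rfl⟩
      rw [mem_band']
      omega
  · exact Finset.image_subset_image (Finset.filter_subset _ _)

theorem min_symbols_of_k_uniform_lower_triangular_tableau
    (r k : ℕ) (hk : 2 ≤ k) (hkk : Even k ∨ (2 * (r : ℤ) - 2 < (k : ℤ))) :
    IsLeast {N : ℕ | ∃ t : ℕ × ℕ → ℕ,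
        IsKUniformLowerTriangular r k t ∧ ((staircase r).image t).card = N}
      (nval r ((k + 1) / 2)) := by
  rw [← band_card r ((k + 1) / 2) (by omega)]
  constructor
  · refine ⟨optT k, optT_uniform hk, ?_⟩
    rw [optT_image hk hkk, Finset.card_image_of_injOn (injOn_band hkk (optT_uniform hk))]
  · rintro N ⟨t, ht, rfl⟩
    rw [← Finset.card_image_of_injOn (injOn_band hkk ht)]
    exact Finset.card_le_card (Finset.image_subset_image (Finset.filter_subset _ _))
end
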